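/- Assume the Continuum Hypothesis. Then there is an ⊑-increasing transfinite sequence ⟨D_α, E_α⟩, α < ω₁, of double-bubble systems on 2^ω, beginning with E_0 = E₀ and D_0 = Eₑ, such that: (1) if X ⊆ 2^ω is a Borel E₀-large set and f : X → 2^ω is Borel and injective, then there exist a canonical E₀-large set Y ⊆ X and an ordinal α < ω₁ such that ⟨D_α, E_α⟩ accommodates f↾Y (i.e., f(x) E_α x for all x ∈ Y); and (2) if X, R ⊆ 2^ω are canonical E₀-large sets, then there exist a canonical E₀-large set Y ⊆ X, an ordinal α < ω₁, and canonical maps f, g : Y → R (maps of the form h_{u,v} with Y = D_u and D_v ⊆ R) such that ⟨D_α, E_α⟩ positively accommodates f (f(x) D_α x for all x ∈ Y) and negatively accommodates g (g(x) E_α x but not g(x) D_α x, for all x ∈ Y). -/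

import Mathlib

open MeasureTheory

abbrev Cantor : Type := ℕ → Bool

/-- The equivalence relation `E₀`: eventual agreement. -/
def eZero (x y : Cantor) : Prop := {k | x k ≠ y k}.Finite

/-- The equivalence relation `Eₑ`: the set of disagreements is finite with even cardinality. -/
def eEven (x y : Cantor) : Prop := {k | x k ≠ y k}.Finite ∧ Even ({k | x k ≠ y k}.ncard)

/-- A set is coanalytic (`Π¹₁`) iff its complement is analytic. -/
def IsCoanalytic {α : Type*} [TopologicalSpace α] (S : Set α) : Prop := AnalyticSet Sᶜ

/-- A perfect set: nonempty, closed, no isolated points. -/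
def PerfectSet (X : Set Cantor) : Prop := Perfect X ∧ X.Nonempty

/-- `E` restricted to the Borel set `X` is smooth. -/
def RelSmoothOn (E : Cantor → Cantor → Prop) (X : Set Cantor) : Prop :=
  ∃ f : X → Cantor, Measurable f ∧ ∀ x y : X, (E x y ↔ f x = f y)

/-- A Borel set is `E₀`-large iff `E₀` restricted to it is not smooth. -/
def E0Large (X : Set Cantor) : Prop := ¬ RelSmoothOn eZero X

/-- An `E₀`-array: strings `u n i` with equal positive lengths and `u n 0 ≠ u n 1`. -/
structure E0Array where
  u : ℕ → Bool → List Bool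
  len_eq : ∀ n, (u n false).length = (u n true).length
  len_pos : ∀ n, 1 ≤ (u n false).length
  ne : ∀ n, u n false ≠ u n true

/-- The point `x_u^a = u 0 (a 0) ⌢ u 1 (a 1) ⌢ ⋯`. (Since every block has length
at least one, the join of the first `m+1` blocks has length `> m`.) -/
def xua (U : E0Array) (a : Cantor) : Cantor := fun m =>
  (((List.range (m + 1)).map (fun n => U.u n (a n))).flatten).getD m false

/-- The canonical `E₀`-large set `D_u` determined by the array `u`. -/
def Du (U : E0Array) : Set Cantor := Set.range (xua U)

/-- A double-bubble system. -/
structure DBS (D E : Cantor → Cantor → Prop) : Prop where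
  equivD : Equivalence D
  equivE : Equivalence E
  borelD : MeasurableSet {p : Cantor × Cantor | D p.1 p.2}
  borelE : MeasurableSet {p : Cantor × Cantor | E p.1 p.2}
  countableD : ∀ x, {y | D x y}.Countable
  countableE : ∀ x, {y | E x y}.Countable
  sub : ∀ x y, D x y → E x y
  double : ∀ x, ∃ y, E x y ∧ ¬ D x y ∧ ∀ z, E x z → (D x z ∨ D y z)

/-- `⟨D,E⟩ ⊑ ⟨D',E'⟩`: extension of double-bubble systems. -/
def DBSle (D E D' E' : Cantor → Cantor → Prop) : Prop :=
  (∀ x y, D x y → D' x y) ∧ (∀ x y, E x y → E' x y) ∧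
    (∀ x y, E x y → ¬ D x y → ¬ D' x y)

open Filter Topology

/-! ### Words and canonical points -/

/-- The concatenation of a finite word with an infinite sequence. -/
def app (w : List Bool) (z : Cantor) : Cantor := fun m => w.getD m (z (m - w.length))

/-- The concatenation of the first `n` blocks selected by `a`. -/
def pre (U : E0Array) (n : ℕ) (a : Cantor) : List Bool :=
  ((List.range n).map (fun k => U.u k (a k))).flatten

theorem app_add (w : List Bool) (z : Cantor) (m : ℕ) : app w z (w.length + m) = z m := by
  simp [app]

theorem app_append (v w : List Bool) (z : Cantor) : app (v ++ w) z = app v (app w z) := by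
  funext m
  rcases lt_or_ge m v.length with h | h
  · simp [app, List.getElem?_append, h]
  · simp [app, List.getElem?_append, not_lt.2 h, Nat.sub_sub]

theorem app_nil (z : Cantor) : app [] z = z := by
  funext m
  simp [app]

theorem app_inj_left {v w : List Bool} {z z' : Cantor} (hl : v.length = w.length)
    (h : app v z = app w z') : v = w := by
  refine List.ext_getElem hl fun m h₁ h₂ => ?_
  simpa [app, h₁, h₂] using congrFun h m

theorem app_ofFn (z : Cantor) (l : ℕ) :
    app (List.ofFn fun i : Fin l => z i) (fun m => z (l + m)) = z := by
  funext m
  rcases lt_or_ge m l with h | h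
  · simp [app, h]
  · simp [app, not_lt.2 h, h]

theorem continuous_app (w : List Bool) : Continuous (app w) := by
  refine continuous_pi fun m => ?_
  rcases lt_or_ge m w.length with h | h
  · simpa [app, h] using continuous_const
  · simpa [app, not_lt.2 h] using continuous_apply _

theorem isOpenMap_app (w : List Bool) : IsOpenMap (app w) := by
  intro V hV
  have h : app w '' V = {x | ∀ i : Fin w.length, x i = w[i]} ∩
      (fun (x : Cantor) m => x (w.length + m)) ⁻¹' V := by
    ext x
    constructor
    · rintro ⟨z, hz, rfl⟩
      refine ⟨fun i => by simp [app], ?_⟩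
      have : (fun m => app w z (w.length + m)) = z := funext fun m => app_add w z m
      simpa [this] using hz
    · rintro ⟨h₁, h₂⟩
      refine ⟨_, h₂, ?_⟩
      funext m
      rcases lt_or_ge m w.length with h | h
      · simpa [app, h] using (h₁ ⟨m, h⟩).symm
      · simp [app, not_lt.2 h, h]
  rw [h]
  refine IsOpen.inter ?_ (hV.preimage (by fun_prop))
  rw [Set.ofPred_forall]
  refine isOpen_iInter_of_finite fun i => ?_
  exact (isOpen_discrete ({w[i]} : Set Bool)).preimage (f := fun x : Cantor => x i)
    (continuous_apply _)

theorem tendsto_of_agree {X : Type*} [TopologicalSpace X] {y : ℕ → ℕ → X} {z : ℕ → X}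
    (h : ∀ n, ∀ i < n, y n i = z i) : Tendsto y atTop (𝓝 z) := by
  refine tendsto_pi_nhds.2 fun i => tendsto_const_nhds.congr' ?_
  filter_upwards [eventually_gt_atTop i] with n hn
  exact (h n i hn).symm

namespace E0Array

variable (U : E0Array)

theorem length_u (n : ℕ) (i : Bool) : (U.u n i).length = (U.u n false).length := by
  cases i
  · rfl
  · exact (U.len_eq n).symm

theorem u_ne {n : ℕ} {i j : Bool} (h : i ≠ j) : U.u n i ≠ U.u n j := by
  cases i <;> cases j <;> first | exact absurd rfl h | exact U.ne n | exact (U.ne n).symm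

end E0Array

theorem pre_succ (U : E0Array) (n : ℕ) (a : Cantor) :
    pre U (n + 1) a = pre U n a ++ U.u n (a n) := by
  simp [pre, List.range_succ]

theorem pre_add (U : E0Array) (n k : ℕ) (a : Cantor) :
    pre U (n + k) a =
      pre U n a ++ ((List.range k).map fun j => U.u (n + j) (a (n + j))).flatten := by
  simp [pre, List.range_add, Function.comp_def]

theorem length_pre (U : E0Array) (n : ℕ) (a b : Cantor) :
    (pre U n a).length = (pre U n b).length := by
  induction n with
  | zero => rfl
  | succ n ih => simp [pre_succ, ih, U.length_u n (a n), U.length_u n (b n)]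

theorem le_length_pre (U : E0Array) (n : ℕ) (a : Cantor) : n ≤ (pre U n a).length := by
  induction n with
  | zero => simp
  | succ n ih =>
    have := U.len_pos n
    simp only [pre_succ, List.length_append, U.length_u n (a n)]
    omega

theorem pre_congr (U : E0Array) {n : ℕ} {a b : Cantor} (h : ∀ k < n, a k = b k) :
    pre U n a = pre U n b := by
  induction n with
  | zero => rfl
  | succ n ih => rw [pre_succ, pre_succ, ih fun k hk => h k (hk.trans n.lt_succ_self),
      h n n.lt_succ_self]

theorem eq_of_pre_eq (U : E0Array) {n : ℕ} {a b : Cantor} (h : pre U n a = pre U n b) :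
    ∀ k < n, a k = b k := by
  induction n with
  | zero => simp
  | succ n ih =>
    rw [pre_succ, pre_succ] at h
    obtain ⟨h₁, h₂⟩ := List.append_inj h (length_pre U n a b)
    intro k hk
    rcases Nat.lt_succ_iff_lt_or_eq.1 hk with hk | rfl
    · exact ih h₁ k hk
    · by_contra hne
      exact U.u_ne hne h₂

theorem getD_pre (U : E0Array) {n n' m : ℕ} (hn : n ≤ n') {a : Cantor}
    (hm : m < (pre U n a).length) : (pre U n' a).getD m false = (pre U n a).getD m false := by
  obtain ⟨k, rfl⟩ := Nat.exists_eq_add_of_le hn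
  rw [pre_add, List.getD_append _ _ _ _ hm]

theorem xua_eq_getD (U : E0Array) {n m : ℕ} {a : Cantor} (hm : m < (pre U n a).length) :
    xua U a m = (pre U n a).getD m false := by
  change (pre U (m + 1) a).getD m false = _
  have h : m < (pre U (m + 1) a).length := le_length_pre U (m + 1) a
  rcases le_total n (m + 1) with h' | h'
  · exact getD_pre U h' hm
  · exact (getD_pre U h' h).symm

theorem xua_eq_app (U : E0Array) (n : ℕ) (a : Cantor) :
    ∃ c, xua U a = app (pre U n a) c := by
  refine ⟨fun m => xua U a ((pre U n a).length + m), ?_⟩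
  funext m
  rcases lt_or_ge m (pre U n a).length with h | h
  · rw [xua_eq_getD U h]
    simp [app, h]
  · simp [app, not_lt.2 h, h]

theorem xua_tail_eq (U : E0Array) {n : ℕ} {a b : Cantor} (h : ∀ k ≥ n, a k = b k) {m : ℕ}
    (hm : (pre U n a).length ≤ m) : xua U a m = xua U b m := by
  obtain ⟨k, hk⟩ := Nat.exists_eq_add_of_le ((le_length_pre U n a).trans hm |>.trans m.le_succ)
  have ha : m < (pre U (n + k) a).length := hk ▸ le_length_pre U (m + 1) a
  have hb : m < (pre U (n + k) b).length := hk ▸ le_length_pre U (m + 1) b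
  rw [xua_eq_getD U ha, xua_eq_getD U hb, pre_add, pre_add, List.getD_append_right _ _ _ _ hm,
    List.getD_append_right _ _ _ _ ((length_pre U n b a).le.trans hm), length_pre U n a b]
  simp only [h _ (Nat.le_add_right n _)]

theorem xua_injective (U : E0Array) : Function.Injective (xua U) := by
  intro a b h
  funext n
  obtain ⟨c, hc⟩ := xua_eq_app U (n + 1) a
  obtain ⟨d, hd⟩ := xua_eq_app U (n + 1) b
  rw [hc, hd] at h
  exact eq_of_pre_eq U (app_inj_left (length_pre U _ a b) h) n n.lt_succ_self

theorem eZero_iff {x y : Cantor} : eZero x y ↔ ∃ n, ∀ k ≥ n, x k = y k := by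
  constructor
  · intro h
    obtain ⟨n, hn⟩ := h.bddAbove
    refine ⟨n + 1, fun k hk => ?_⟩
    by_contra hne
    exact absurd (hn hne) (by omega)
  · rintro ⟨n, hn⟩
    refine (Set.finite_lt_nat n).subset fun k hk => ?_
    by_contra hne
    exact hk (hn k (not_lt.1 hne))

theorem eZero_xua (U : E0Array) {a b : Cantor} (h : eZero a b) : eZero (xua U a) (xua U b) := by
  obtain ⟨n, hn⟩ := eZero_iff.1 h
  exact eZero_iff.2 ⟨_, fun k hk => xua_tail_eq U hn hk⟩

theorem eZero_equivalence : Equivalence eZero := by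
  refine ⟨fun x => by simp [eZero], fun {x y} h => by simpa only [eZero, ne_comm] using h,
    fun {x y z} h h' => ?_⟩
  refine (h.union h').subset fun k hk => ?_
  by_contra hne
  simp only [Set.mem_union, Set.mem_ofPred_eq, not_or, not_not] at hne
  exact hk (hne.1.trans hne.2)

theorem continuous_xua (U : E0Array) : Continuous (xua U) := by
  refine continuous_pi fun m => ?_
  let g : (Fin (m + 1) → Bool) → Bool := fun s =>
    xua U (fun k => if h : k < m + 1 then s ⟨k, h⟩ else false) m
  have h : (fun a => xua U a m) = g ∘ fun a i => a i := by
    funext a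
    change (pre U (m + 1) _).getD m false = (pre U (m + 1) _).getD m false
    congr 1
    exact pre_congr U fun k hk => by simp [hk]
  rw [h]
  exact continuous_of_discreteTopology.comp (continuous_pi fun i => continuous_apply _)

/-- Canonical maps compose: a canonical subset of a canonical set is canonical. -/
theorem exists_xua_comp (U w : E0Array) : ∃ V : E0Array, ∀ a, xua V a = xua U (xua w a) := by
  let off : ℕ → ℕ := fun n => (pre w n fun _ => false).length
  have hoff : ∀ n a, (pre w n a).length = off n := fun n a => length_pre w n a _
  let v : ℕ → Bool → List Bool := fun n i => ((List.range (w.u n false).length).map fun j =>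
    U.u (off n + j) ((w.u n i).getD j false)).flatten
  have hv : ∀ n a, ((List.range n).map fun k => v k (a k)).flatten = pre U (off n) (xua w a) := by
    intro n a
    induction n with
    | zero => rfl
    | succ n ih =>
      have : off (n + 1) = off n + (w.u n false).length := by simp [off, pre_succ]
      rw [List.range_succ, List.map_append, List.flatten_append, ih, this, pre_add]
      simp only [v, List.map_cons, List.map_nil, List.flatten_cons, List.flatten_nil,
        List.append_nil]
      congr 2
      refine List.map_congr_left fun j hj => ?_
      rw [List.mem_range] at hj
      have hlt : off n + j < (pre w (n + 1) a).length := by rw [hoff, this]; omega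
      rw [xua_eq_getD w hlt, pre_succ, List.getD_append_right _ _ _ _ (by rw [hoff]; omega), hoff]
      simp
  have hlen : ∀ n, (v n false).length = (v n true).length := by
    intro n
    simp only [v, List.length_flatten, List.map_map]
    congr 1
    refine List.map_congr_left fun j _ => ?_
    simp only [Function.comp]
    rw [U.length_u, U.length_u (off n + j) ((w.u n true).getD j false)]
  have hne : ∀ n, v n false ≠ v n true := by
    intro n h
    have key : pre U (off (n + 1)) (xua w fun _ => false) =
        pre U (off (n + 1)) (xua w fun k => decide (k = n)) := by
      rw [← hv, ← hv]
      congr 1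
      refine List.map_congr_left fun k _ => ?_
      by_cases hk : k = n
      · subst hk
        simpa using h
      · simp [hk]
    have hk := eq_of_pre_eq U key
    obtain ⟨c, hc⟩ := xua_eq_app w (n + 1) fun _ => false
    obtain ⟨d, hd⟩ := xua_eq_app w (n + 1) fun k => decide (k = n)
    have hw : pre w (n + 1) (fun _ => false) = pre w (n + 1) fun k => decide (k = n) := by
      refine List.ext_getElem (length_pre w _ _ _) fun m h₁ h₂ => ?_
      have := hk m h₁
      rw [hc, hd] at this
      simpa [app, h₁, h₂] using this
    simpa using eq_of_pre_eq w hw n n.lt_succ_self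
  refine ⟨⟨v, hlen, fun n => ?_, hne⟩, fun a => ?_⟩
  · by_contra h
    have h₀ : (v n false).length = 0 := by omega
    have h₁ : (v n true).length = 0 := by rw [← hlen n, h₀]
    exact hne n (by rw [List.length_eq_zero_iff.1 h₀, List.length_eq_zero_iff.1 h₁])
  · funext m
    have hle : m < off (m + 1) := le_length_pre w (m + 1) _
    rw [xua_eq_getD U (n := off (m + 1)) (hle.trans_le (le_length_pre U _ _)), ← hv]
    rfl

/-! ### Finite flips -/

/-- Flip the bits of `x` at the places in `F`. -/
def flipAt (F : Finset ℕ) (x : Cantor) : Cantor := fun n => xor (x n) (decide (n ∈ F))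

theorem flipAt_flipAt_self (F : Finset ℕ) (x : Cantor) : flipAt F (flipAt F x) = x := by
  funext n
  simp [flipAt]

theorem flipAt_eq_self_iff {F : Finset ℕ} {x : Cantor} : flipAt F x = x ↔ F = ∅ := by
  constructor
  · intro h
    refine Finset.eq_empty_of_forall_notMem fun n hn => ?_
    simpa [flipAt, hn] using congrFun h n
  · rintro rfl
    funext n
    simp [flipAt]

theorem ne_flipAt_iff (F : Finset ℕ) (x : Cantor) (n : ℕ) : x n ≠ flipAt F x n ↔ n ∈ F := by
  simp only [flipAt]
  cases x n <;> simp

theorem continuous_flipAt (F : Finset ℕ) : Continuous (flipAt F) := by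
  refine continuous_pi fun n => ?_
  exact (continuous_of_discreteTopology (f := fun b : Bool => xor b (decide (n ∈ F)))).comp
    (continuous_apply n)

theorem eZero_flipAt (F : Finset ℕ) (x : Cantor) : eZero x (flipAt F x) := by
  refine F.finite_toSet.subset fun n hn => ?_
  exact (ne_flipAt_iff F x n).1 hn

theorem exists_flipAt_of_eZero {x y : Cantor} (h : eZero x y) : ∃ F, y = flipAt F x := by
  refine ⟨h.toFinset, ?_⟩
  funext n
  have hn : n ∈ h.toFinset ↔ x n ≠ y n := h.mem_toFinset
  simp only [flipAt, hn]
  cases x n <;> cases y n <;> rfl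

theorem exists_flipAt_app {v w : List Bool} (h : v.length = w.length) :
    ∃ F, ∀ z, app w z = flipAt F (app v z) := by
  refine ⟨(Finset.range v.length).filter fun n => v.getD n false ≠ w.getD n false, fun z => ?_⟩
  funext n
  rcases lt_or_ge n v.length with hn | hn
  · have hn' : n < w.length := h ▸ hn
    simp only [flipAt, app, List.getD_eq_getElem, hn, hn', Finset.mem_filter, Finset.mem_range,
      true_and]
    cases v[n] <;> cases w[n] <;> simp
  · simp [flipAt, app, h ▸ hn, h]

theorem measurableSet_eZero : MeasurableSet {p : Cantor × Cantor | eZero p.1 p.2} := by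
  have : {p : Cantor × Cantor | eZero p.1 p.2} = ⋃ F, {p | p.2 = flipAt F p.1} := by
    ext p
    simp only [Set.mem_ofPred_eq, Set.mem_iUnion]
    exact ⟨exists_flipAt_of_eZero, fun ⟨F, hF⟩ => hF ▸ eZero_flipAt F p.1⟩
  rw [this]
  exact MeasurableSet.iUnion fun F =>
    measurableSet_eq_fun measurable_snd ((continuous_flipAt F).measurable.comp measurable_fst)

/-! ### Sets covered by countably many Borel partial transversals -/

/-- `B` meets every `H`-class in at most one point. -/
def IsPartialTransversal (H : Cantor → Cantor → Prop) (B : Set Cantor) : Prop :=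
  ∀ x ∈ B, ∀ y ∈ B, H x y → x = y

/-- `A` is covered by countably many Borel partial transversals of `H`. -/
def TransversallySmall (H : Cantor → Cantor → Prop) (A : Set Cantor) : Prop :=
  ∃ B : ℕ → Set Cantor, (∀ n, MeasurableSet (B n)) ∧ (∀ n, IsPartialTransversal H (B n)) ∧
    A ⊆ ⋃ n, B n

namespace TransversallySmall

variable {H : Cantor → Cantor → Prop} {A A' : Set Cantor}

theorem mono (h : TransversallySmall H A') (hA : A ⊆ A') : TransversallySmall H A := by
  obtain ⟨B, hm, ht, hc⟩ := h
  exact ⟨B, hm, ht, hA.trans hc⟩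

theorem of_isPartialTransversal (hm : MeasurableSet A) (ht : IsPartialTransversal H A) :
    TransversallySmall H A :=
  ⟨fun _ => A, fun _ => hm, fun _ => ht,
    fun _ hx => Set.mem_iUnion.2 ⟨0, hx⟩⟩

theorem empty : TransversallySmall H ∅ :=
  of_isPartialTransversal MeasurableSet.empty (by simp [IsPartialTransversal])

theorem iUnion {ι : Type*} [Countable ι] {A : ι → Set Cantor}
    (h : ∀ i, TransversallySmall H (A i)) : TransversallySmall H (⋃ i, A i) := by
  rcases isEmpty_or_nonempty ι with hι | hι
  · simpa using empty
  choose B hm ht hc using h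
  obtain ⟨e, he⟩ := exists_surjective_nat (ι × ℕ)
  refine ⟨fun n => B (e n).1 (e n).2, fun n => hm _ _, fun n => ht _ _, ?_⟩
  refine Set.iUnion_subset fun i x hx => ?_
  obtain ⟨k, hk⟩ := Set.mem_iUnion.1 (hc i hx)
  obtain ⟨n, hn⟩ := he (i, k)
  exact Set.mem_iUnion.2 ⟨n, by simpa [hn] using hk⟩

theorem union (h : TransversallySmall H A) (h' : TransversallySmall H A') :
    TransversallySmall H (A ∪ A') := by
  rw [Set.union_eq_iUnion]
  exact iUnion fun b => by cases b <;> assumption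

theorem exists_measurableSet (h : TransversallySmall H A) :
    ∃ B, A ⊆ B ∧ MeasurableSet B ∧ TransversallySmall H B := by
  obtain ⟨B, hm, ht, hc⟩ := h
  exact ⟨_, hc, MeasurableSet.iUnion hm, B, hm, ht, subset_rfl⟩

end TransversallySmall

theorem MeasureTheory.AnalyticSet.inter {X : Type*} [TopologicalSpace X] [T2Space X]
    {s t : Set X} (hs : AnalyticSet s) (ht : AnalyticSet t) : AnalyticSet (s ∩ t) := by
  rw [Set.inter_eq_iInter]
  exact AnalyticSet.iInter fun b => by cases b <;> assumption

instance polishSpace_cantor : PolishSpace Cantor := by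
  have : TopologicalSpace.IsCompletelyMetrizableSpace Cantor :=
    TopologicalSpace.IsCompletelyMetrizableSpace.pi_countable
  infer_instance

theorem TransversallySmall.of_analyticSet {H : Cantor → Cantor → Prop} {A : Set Cantor}
    (hH : MeasurableSet {p : Cantor × Cantor | H p.1 p.2}) (hH₀ : ∀ x y, H x y → eZero x y)
    (hA : AnalyticSet A) (ht : IsPartialTransversal H A) : TransversallySmall H A := by
  have hHF : ∀ F, MeasurableSet {x | H x (flipAt F x)} := fun F =>
    hH.preimage (measurable_id.prodMk (continuous_flipAt F).measurable)
  have hsep : ∀ F : {F : Finset ℕ // F ≠ ∅}, ∃ S, A ⊆ S ∧ MeasurableSet S ∧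
      ∀ x ∈ A, H x (flipAt F x) → flipAt F x ∉ S := by
    intro F
    have hAF : AnalyticSet (flipAt F '' (A ∩ {x | H x (flipAt F x)})) :=
      (hA.inter (hHF F).analyticSet).image_of_continuous (continuous_flipAt F)
    obtain ⟨S, hS, hd, hm⟩ := hA.measurablySeparable hAF (by
      rw [Set.disjoint_left]
      rintro _ hy ⟨x, ⟨hx, hxF⟩, rfl⟩
      exact F.2 (flipAt_eq_self_iff.1 (ht x hx _ hy hxF).symm))
    exact ⟨S, hS, hm, fun x hx hxF => Set.disjoint_left.1 hd ⟨x, ⟨hx, hxF⟩, rfl⟩⟩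
  choose S hAS hS hSA using hsep
  refine mono (A' := ⋂ F, S F \ (flipAt F ⁻¹' S F ∩ {x | H x (flipAt F x)}))
    (of_isPartialTransversal (MeasurableSet.iInter fun F => (hS F).diff
      (((hS F).preimage (continuous_flipAt F).measurable).inter (hHF F))) ?_) ?_
  · intro x hx y hy hxy
    obtain ⟨F, rfl⟩ := exists_flipAt_of_eZero (hH₀ x y hxy)
    by_contra hne
    have hF : F ≠ ∅ := fun h => hne (flipAt_eq_self_iff.2 h).symm
    exact (Set.mem_iInter.1 hx ⟨F, hF⟩).2 ⟨(Set.mem_iInter.1 hy ⟨F, hF⟩).1, hxy⟩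
  · refine Set.subset_iInter fun F x hx => ⟨hAS F hx, fun h => ?_⟩
    exact hSA F x hx h.2 h.1

/-- A transversally small set for `E₀` is smooth. -/
theorem TransversallySmall.relSmoothOn {X : Set Cantor} (h : TransversallySmall eZero X) :
    RelSmoothOn eZero X := by
  obtain ⟨B, hm, ht, hc⟩ := h
  let S : ℕ → ℕ → Set Cantor := fun n k =>
    ⋃ F, flipAt F ⁻¹' (B n ∩ {y | k = 0 ∨ y (k - 1) = true})
  have hS : ∀ n k, MeasurableSet (S n k) := fun n k => MeasurableSet.iUnion fun F => by
    refine MeasurableSet.preimage ((hm n).inter ?_) (continuous_flipAt F).measurable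
    rw [Set.ofPred_or]
    exact (MeasurableSet.const _).union ((measurable_pi_apply (k - 1)) (measurableSet_singleton _))
  have hSmem : ∀ n k x, x ∈ S n k ↔ ∃ y ∈ B n, eZero x y ∧ (k = 0 ∨ y (k - 1) = true) := by
    intro n k x
    simp only [S, Set.mem_iUnion, Set.mem_preimage, Set.mem_inter_iff, Set.mem_ofPred_eq]
    constructor
    · rintro ⟨F, h₁, h₂⟩
      exact ⟨_, h₁, eZero_flipAt F x, h₂⟩
    · rintro ⟨y, hy, hxy, hk⟩
      obtain ⟨F, rfl⟩ := exists_flipAt_of_eZero hxy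
      exact ⟨F, hy, hk⟩
  classical
  refine ⟨fun x j => decide ((x : Cantor) ∈ S j.unpair.1 j.unpair.2), ?_, fun x y => ?_⟩
  · refine measurable_pi_iff.2 fun j => ?_
    refine measurable_to_bool ?_
    have : (fun x : X => decide ((x : Cantor) ∈ S j.unpair.1 j.unpair.2)) ⁻¹' {true} =
        Subtype.val ⁻¹' S j.unpair.1 j.unpair.2 := by
      ext x
      simp
    rw [this]
    exact (hS _ _).preimage measurable_subtype_coe
  · constructor
    · intro hxy
      funext j
      simp only [decide_eq_decide, hSmem]
      exact exists_congr fun z => and_congr_right fun _ => and_congr_left fun _ =>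
        ⟨eZero_equivalence.trans (eZero_equivalence.symm hxy), eZero_equivalence.trans hxy⟩
    · intro hxy
      have hiff : ∀ n k, (x : Cantor) ∈ S n k ↔ (y : Cantor) ∈ S n k := fun n k => by
        simpa using congrFun hxy (Nat.pair n k)
      obtain ⟨n, hn⟩ := Set.mem_iUnion.1 (hc x.2)
      obtain ⟨z, hz, hyz, -⟩ := (hSmem n 0 y).1 ((hiff n 0).1
        ((hSmem n 0 x).2 ⟨x, hn, eZero_equivalence.refl _, Or.inl rfl⟩))
      suffices (x : Cantor) = z from this ▸ eZero_equivalence.symm hyz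
      funext k
      rw [Bool.eq_iff_iff]
      have hbit : ∀ (u v : Cantor), eZero u v → v ∈ B n → (u ∈ S n (k + 1) ↔ v k = true) := by
        intro u v huv hv
        rw [hSmem]
        constructor
        · rintro ⟨v', hv', huv', h⟩
          rw [ht n v hv v' hv' (eZero_equivalence.trans (eZero_equivalence.symm huv) huv')]
          simpa using h
        · exact fun h => ⟨v, hv, huv, Or.inr (by simpa using h)⟩
      rw [← hbit x x (eZero_equivalence.refl _) hn, ← hbit y z hyz hz]
      exact hiff n (k + 1)

/-! ### The dichotomy for Borel subequivalences of `E₀` -/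

theorem exists_closed_parametrization {H : Cantor → Cantor → Prop}
    (hH : MeasurableSet {p : Cantor × Cantor | H p.1 p.2}) {X : Set Cantor}
    (hX : MeasurableSet X) (hne : X.Nonempty) :
    ∃ φ : (ℕ → ℕ) → Cantor, Continuous φ ∧ Set.range φ = X ∧
      ∀ F, IsClosed {y | H (φ y) (flipAt F (φ y))} := by
  classical
  let Φ : Cantor → Finset ℕ → Bool := fun x F => decide (H x (flipAt F x))
  have hΦ : Measurable Φ := by
    refine measurable_pi_iff.2 fun F => measurable_to_bool ?_
    have : (fun x => Φ x F) ⁻¹' {true} = {x | H x (flipAt F x)} := by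
      ext x
      simp [Φ]
    rw [this]
    exact hH.preimage (measurable_id.prodMk (continuous_flipAt F).measurable)
  have hG : AnalyticSet ((fun x => (x, Φ x)) '' X) :=
    hX.analyticSet_image (measurable_id.prodMk hΦ)
  rw [AnalyticSet] at hG
  rcases hG with hG | ⟨ψ, hψ, hr⟩
  · exact absurd hG (hne.image _).ne_empty
  have key : ∀ y, (ψ y).1 ∈ X ∧ (ψ y).2 = Φ (ψ y).1 := fun y => by
    obtain ⟨x, hx, hxy⟩ := hr ▸ Set.mem_range_self y
    rw [← hxy]
    exact ⟨hx, rfl⟩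
  refine ⟨fun y => (ψ y).1, hψ.fst, ?_, fun F => ?_⟩
  · ext x
    constructor
    · rintro ⟨y, rfl⟩
      exact (key y).1
    · intro hx
      obtain ⟨y, hy⟩ : (x, Φ x) ∈ Set.range ψ := hr ▸ Set.mem_image_of_mem _ hx
      exact ⟨y, by simp [hy]⟩
  · have : {y | H (ψ y).1 (flipAt F (ψ y).1)} = (fun y => (ψ y).2 F) ⁻¹' {true} := by
      ext y
      simp [(key y).2, Φ]
    rw [this]
    exact isClosed_singleton.preimage ((continuous_apply F).comp hψ.snd)

namespace Dichotomy

/-- A finite approximation: words together with initial segments of witnesses. -/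
abbrev Approx (n : ℕ) : Type := (Fin n → Bool) → List Bool × (Fin n → ℕ)

variable (H : Cantor → Cantor → Prop) (φ : (ℕ → ℕ) → Cantor)

/-- The tails realizing an approximation. -/
def tails {n : ℕ} (p : Approx n) : Set Cantor :=
  {z | ∀ s, (∃ y, (∀ i : Fin n, y i = (p s).2 i) ∧ φ y = app (p s).1 z) ∧
    H (app (p fun _ => false).1 z) (app (p s).1 z)}

/-- The leftmost points realizing an approximation. -/
def values {n : ℕ} (p : Approx n) : Set Cantor :=
  app (p fun _ => false).1 '' tails H φ p

/-- `p'` extends `p` by one block. -/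
def Extends {n : ℕ} (p : Approx n) (B : Bool → List Bool) (p' : Approx (n + 1)) : Prop :=
  ∀ s, (p' s).1 = (p (Fin.init s)).1 ++ B (s (Fin.last n)) ∧
    ∀ i : Fin n, (p' s).2 i.castSucc = (p (Fin.init s)).2 i

variable {H φ}

theorem analyticSet_values (hH : MeasurableSet {p : Cantor × Cantor | H p.1 p.2})
    (hφ : Continuous φ) {n : ℕ} (p : Approx n) : AnalyticSet (values H φ p) := by
  refine AnalyticSet.image_of_continuous ?_ (continuous_app _)
  rw [tails, Set.ofPred_forall]
  refine AnalyticSet.iInter fun s => ?_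
  rw [Set.ofPred_and]
  refine AnalyticSet.inter ?_ (MeasurableSet.analyticSet ?_)
  · have hcyl : IsClosed {y : ℕ → ℕ | ∀ i : Fin n, y i = (p s).2 i} := by
      rw [Set.ofPred_forall]
      exact isClosed_iInter fun i => isClosed_eq (continuous_apply _) continuous_const
    exact (hcyl.analyticSet.image_of_continuous hφ).preimage (continuous_app (p s).1)
  · exact hH.preimage ((continuous_app _).measurable.prodMk (continuous_app _).measurable)

theorem exists_common_small_set : ∃ N, MeasurableSet N ∧ TransversallySmall H N ∧
    ∀ {n : ℕ} (p : Approx n), TransversallySmall H (values H φ p) → values H φ p ⊆ N := by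
  have h : ∀ p : Σ n, Approx n, ∃ B, MeasurableSet B ∧ TransversallySmall H B ∧
      (TransversallySmall H (values H φ p.2) → values H φ p.2 ⊆ B) := by
    intro p
    by_cases hp : TransversallySmall H (values H φ p.2)
    · obtain ⟨B, hB, hm, hs⟩ := hp.exists_measurableSet
      exact ⟨B, hm, hs, fun _ => hB⟩
    · exact ⟨∅, MeasurableSet.empty, .empty, fun h => absurd h hp⟩
  choose B hm hs hB using h
  exact ⟨⋃ p, B p, MeasurableSet.iUnion hm, .iUnion hs,
    fun p hp => (hB ⟨_, p⟩ hp).trans (Set.subset_iUnion B ⟨_, p⟩)⟩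

theorem exists_extension (hH : MeasurableSet {p : Cantor × Cantor | H p.1 p.2})
    (he : Equivalence H) (hH₀ : ∀ x y, H x y → eZero x y) (hφ : Continuous φ) {n : ℕ}
    {p : Approx n} (hp : ¬ TransversallySmall H (values H φ p)) :
    ∃ B : Bool → List Bool, ((B false).length = (B true).length ∧ 1 ≤ (B false).length ∧
      B false ≠ B true) ∧ ∃ p' : Approx (n + 1), ¬ TransversallySmall H (values H φ p') ∧
        Extends p B p' := by
  obtain ⟨N, hNm, hNs, hN⟩ := exists_common_small_set (H := H) (φ := φ)
  have hne : ¬ IsPartialTransversal H (values H φ p ∩ Nᶜ) := fun ht => hp <| by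
    refine ((TransversallySmall.of_analyticSet hH hH₀
      ((analyticSet_values hH hφ p).inter hNm.compl.analyticSet) ht).union hNs).mono fun x hx => ?_
    by_cases hxN : x ∈ N
    · exact Or.inr hxN
    · exact Or.inl ⟨hx, hxN⟩
  simp only [IsPartialTransversal, not_forall] at hne
  obtain ⟨_, ⟨⟨z₀, hz₀, rfl⟩, hzN⟩, _, ⟨⟨z₁, hz₁, rfl⟩, -⟩, hHz, hz⟩ := hne
  obtain ⟨m, hm⟩ := eZero_iff.1 (hH₀ _ _ hHz)
  set w := (p fun _ => false).1
  have hm' : ∀ k ≥ m, z₀ k = z₁ k := fun k hk => by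
    rw [← app_add w z₀ k, ← app_add w z₁ k, hm _ (by omega)]
  have hz' : z₀ ≠ z₁ := fun h => hz (by rw [h])
  let zz : Bool → Cantor := fun i => bif i then z₁ else z₀
  let B : Bool → List Bool := fun i => List.ofFn fun k : Fin (m + 1) => zz i k
  let c : Cantor := fun k => z₀ (m + 1 + k)
  have hBc : ∀ i, app (B i) c = zz i := by
    intro i
    have hc : c = fun k => zz i (m + 1 + k) := by
      funext k
      cases i
      · rfl
      · exact hm' _ (by omega)
    rw [hc]
    exact app_ofFn (zz i) (m + 1)
  have hzz : ∀ i, zz i ∈ tails H φ p := fun i => by cases i <;> assumption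
  have hw : ∀ i, H (app w z₀) (app w (zz i)) := fun i => by
    cases i
    · exact he.refl _
    · exact hHz
  choose y hy using fun (s : Fin (n + 1) → Bool) => (hzz (s (Fin.last n)) (Fin.init s)).1
  let p' : Approx (n + 1) := fun s =>
    ((p (Fin.init s)).1 ++ B (s (Fin.last n)), fun i => y s i)
  have hp'c : ∀ s, app (p' s).1 c = app (p (Fin.init s)).1 (zz (s (Fin.last n))) := fun s => by
    simp only [p', app_append, hBc]
  have h₀ : app (p' fun _ => false).1 c = app w z₀ := hp'c _
  refine ⟨B, ⟨by simp [B], by simp [B], fun h => hz' ?_⟩, p', fun hs => hzN ?_,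
    fun s => ⟨rfl, fun i => (hy s).1 i⟩⟩
  · have h' := hBc true
    rw [← h, hBc false] at h'
    exact h'
  · refine hN p' hs ⟨c, fun s => ⟨⟨y s, fun i => rfl, (hy s).2.trans (hp'c s).symm⟩, ?_⟩, h₀⟩
    rw [h₀, hp'c]
    exact he.trans (hw _) ((hzz _) _).2

end Dichotomy

open Dichotomy in
/-- Either a Borel set is covered by countably many Borel partial transversals of `H`, or it
contains a canonical `E₀`-large set on which `H` coincides with `E₀`. -/
theorem transversallySmall_or_exists_canonical {H : Cantor → Cantor → Prop}
    (hH : MeasurableSet {p : Cantor × Cantor | H p.1 p.2}) (he : Equivalence H)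
    (hH₀ : ∀ x y, H x y → eZero x y) {X : Set Cantor} (hX : MeasurableSet X) :
    TransversallySmall H X ∨
      ∃ U, Du U ⊆ X ∧ ∀ a b, eZero a b → H (xua U a) (xua U b) := by
  refine or_iff_not_imp_left.2 fun hXs => ?_
  have hne : X.Nonempty := Set.nonempty_iff_ne_empty.2 fun h => hXs (h ▸ .empty)
  obtain ⟨φ, hφ, hr, hcl⟩ := exists_closed_parametrization hH hX hne
  have hp₀ : ¬ TransversallySmall H (values H φ (fun _ => ([], Fin.elim0) : Approx 0)) := by
    refine fun h => hXs (h.mono fun x hx => ?_)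
    obtain ⟨y, rfl⟩ := hr ▸ hx
    refine ⟨φ y, fun s => ⟨⟨y, fun i => i.elim0, ?_⟩, he.refl _⟩, ?_⟩ <;> simp only [app_nil]
  have step : ∀ n (p : {p : Approx n // ¬ TransversallySmall H (values H φ p)}),
      ∃ (B : Bool → List Bool) (p' : {p : Approx (n + 1) // ¬ TransversallySmall H (values H φ p)}),
        ((B false).length = (B true).length ∧ 1 ≤ (B false).length ∧ B false ≠ B true) ∧
        Extends p.1 B p'.1 := fun n p => by
    obtain ⟨B, hB, p', hp', hpp'⟩ := exists_extension hH he hH₀ hφ p.2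
    exact ⟨B, ⟨p', hp'⟩, hB, hpp'⟩
  choose B nxt hB hext using step
  let seq : ∀ n, {p : Approx n // ¬ TransversallySmall H (values H φ p)} := fun n =>
    Nat.rec ⟨_, hp₀⟩ (fun n p => nxt n p) n
  let U : E0Array := ⟨fun n => B n (seq n), fun n => (hB n (seq n)).1, fun n => (hB n (seq n)).2.1,
    fun n => (hB n (seq n)).2.2⟩
  have hseq : ∀ n, Extends (seq n).1 (U.u n) (seq (n + 1)).1 := fun n => hext n (seq n)
  have hword : ∀ n (a : Cantor), ((seq n).1 fun i => a i).1 = pre U n a := by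
    intro n a
    induction n with
    | zero => rfl
    | succ n ih =>
      rw [((hseq n) _).1, pre_succ, ← ih]
      rfl
  let lim : Cantor → ℕ → ℕ := fun a i => ((seq (i + 1)).1 fun j => a j).2 (Fin.last i)
  have hlim : ∀ n (a : Cantor) (i : Fin n), ((seq n).1 fun j => a j).2 i = lim a i := by
    intro n a
    induction n with
    | zero => exact fun i => i.elim0
    | succ n ih =>
      intro i
      induction i using Fin.lastCases with
      | last => rfl
      | cast i =>
        rw [((hseq n) _).2 i]
        exact ih i
  have htail : ∀ n, ∃ z, z ∈ tails H φ (seq n).1 := fun n => by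
    by_contra h
    refine (seq n).2 ?_
    rw [values, Set.eq_empty_iff_forall_notMem.2 (not_exists.1 h), Set.image_empty]
    exact .empty
  choose c hc using htail
  have hpt : ∀ n (a : Cantor), ∃ y, (∀ i < n, y i = lim a i) ∧ φ y = app (pre U n a) (c n) := by
    intro n a
    obtain ⟨⟨y, hy, hφy⟩, -⟩ := hc n fun i => a i
    exact ⟨y, fun i hi => (hy ⟨i, hi⟩).trans (hlim n a ⟨i, hi⟩), by rw [hφy, hword]⟩
  choose y hy hφy using hpt
  have hylim : ∀ a, Tendsto (fun n => y n a) atTop (𝓝 (lim a)) := fun a =>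
    tendsto_of_agree fun n i hi => hy n a i hi
  have hφlim : ∀ a, φ (lim a) = xua U a := by
    intro a
    refine tendsto_nhds_unique ((hφ.tendsto _).comp (hylim a)) (tendsto_of_agree fun n i hi => ?_)
    have hlt : i < (pre U n a).length := hi.trans_le (le_length_pre U n a)
    rw [Function.comp_apply, hφy, xua_eq_getD U hlt]
    simp [app, hlt]
  refine ⟨U, ?_, fun a b hab => ?_⟩
  · rintro _ ⟨a, rfl⟩
    exact hr ▸ ⟨lim a, hφlim a⟩
  · obtain ⟨m, hm⟩ := eZero_iff.1 hab
    obtain ⟨F, hF⟩ := exists_flipAt_app (length_pre U m a b)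
    have hflip : ∀ n ≥ m, ∀ z, app (pre U n b) z = flipAt F (app (pre U n a) z) := by
      intro n hn z
      obtain ⟨k, rfl⟩ := Nat.exists_eq_add_of_le hn
      rw [pre_add, pre_add, app_append, app_append, hF]
      simp only [hm _ (Nat.le_add_right m _)]
    have hmem : lim a ∈ {y | H (φ y) (flipAt F (φ y))} := by
      refine (hcl F).mem_of_tendsto (hylim a) ?_
      filter_upwards [eventually_ge_atTop m] with n hn
      rw [hφy, ← hflip n hn, ← hword n a, ← hword n b]
      exact he.trans (he.symm (hc n _).2) (hc n _).2
    have hxb : xua U b = flipAt F (xua U a) := by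
      funext i
      have hlt : ∀ a, i < (pre U (max m (i + 1)) a).length := fun a =>
        (Nat.lt_of_succ_le (le_max_right m (i + 1))).trans_le (le_length_pre U _ a)
      have h := congrFun (hflip _ (le_max_left m (i + 1)) (c 0)) i
      simp only [app, flipAt, List.getD_eq_getElem, hlt] at h
      simp only [flipAt, xua_eq_getD U (hlt _), List.getD_eq_getElem, hlt, h]
    have hfin : H (φ (lim a)) (flipAt F (φ (lim a))) := hmem
    rwa [hφlim, ← hxb] at hfin

/-! ### Baire category -/

theorem isMeagre_of_forall_notMem {Z : Type*} [TopologicalSpace Z] [BaireSpace Z]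
    [MeasurableSpace Z] [BorelSpace Z] {T : ℕ → Z → Z} (hc : ∀ k, Continuous (T k))
    (ho : ∀ k, IsOpenMap (T k)) (ht : ∀ z, Tendsto (fun k => T k z) atTop (𝓝 z)) {B : Set Z}
    (hB : MeasurableSet B) (h : ∀ k, ∀ z ∈ B, T k z ∉ B) : IsMeagre B := by
  obtain ⟨O, hO, hBO⟩ := hB.residualEq_isOpen
  rcases O.eq_empty_or_nonempty with rfl | ⟨z, hz⟩
  · filter_upwards [hBO] with y hy hyB
    exact (hy ▸ hyB : (∅ : Set Z) y)
  · obtain ⟨k, hk⟩ := ((ht z).eventually (hO.mem_nhds hz)).exists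
    have hres : {y | ¬ (y ∈ O ∧ T k y ∈ O)} ∈ residual Z := by
      filter_upwards [hBO, (tendsto_residual_of_isOpenMap (hc k) (ho k)).eventually hBO]
        with y h₁ h₂ ⟨h₃, h₄⟩
      exact h k y (h₁.symm ▸ h₃ : B y) (h₂.symm ▸ h₄ : B (T k y))
    obtain ⟨y, hy, hy'⟩ := (dense_of_mem_residual hres).inter_open_nonempty _
      (hO.inter (hO.preimage (hc k))) ⟨z, hz, hk⟩
    exact absurd hy hy'

theorem isOpenMap_flipAt (F : Finset ℕ) : IsOpenMap (flipAt F) :=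
  (Homeomorph.mk ⟨flipAt F, flipAt F, flipAt_flipAt_self F, flipAt_flipAt_self F⟩
    (continuous_flipAt F) (continuous_flipAt F)).isOpenMap

theorem tendsto_flipAt_singleton (x : Cantor) :
    Tendsto (fun k => flipAt {k} x) atTop (𝓝 x) :=
  tendsto_of_agree fun n i hi => by simp [flipAt, hi.ne]

theorem not_transversallySmall_univ : ¬ TransversallySmall eZero Set.univ := by
  rintro ⟨B, hm, ht, hc⟩
  have h : IsMeagre (⋃ n, B n) := isMeagre_iUnion fun n =>
    isMeagre_of_forall_notMem (fun k => continuous_flipAt {k}) (fun k => isOpenMap_flipAt {k})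
      tendsto_flipAt_singleton (hm n) fun k z hz hz' =>
        Finset.singleton_ne_empty k
          (flipAt_eq_self_iff.1 (ht n z hz _ hz' (eZero_flipAt _ z)).symm)
  rw [Set.univ_subset_iff.1 hc] at h
  exact not_isMeagre_of_isOpen isOpen_univ Set.univ_nonempty h

theorem isMeagre_of_forall_eq {R : Set (Cantor × Cantor)} (hR : MeasurableSet R)
    (h : ∀ a b c, (a, b) ∈ R → (a, c) ∈ R → b = c) : IsMeagre R := by
  refine isMeagre_of_forall_notMem (T := fun k => Prod.map id (flipAt {k}))
    (fun k => continuous_id.prodMap (continuous_flipAt _))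
    (fun k => IsOpenMap.id.prodMap (isOpenMap_flipAt _))
    (fun z => (tendsto_const_nhds).prodMk_nhds (tendsto_flipAt_singleton z.2)) hR
    fun k z hz hz' => Finset.singleton_ne_empty k (flipAt_eq_self_iff.1 (h _ _ _ hz hz').symm)

/-! ### Perfectly many mutually generic points -/

theorem dense_setOf_ne : Dense {z : Cantor × Cantor | z.1 ≠ z.2} := by
  intro z
  let y : ℕ → Cantor := fun n => Function.update z.2 n (!z.1 n)
  have hy : Tendsto (fun n => (z.1, y n)) atTop (𝓝 z) :=
    tendsto_const_nhds.prodMk_nhds (tendsto_of_agree fun n i hi => by simp [y, hi.ne])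
  refine mem_closure_of_tendsto hy (Eventually.of_forall fun n h => ?_)
  have := congrFun h n
  simp [y] at this

theorem exists_generic_block {P : ℕ → Set (Cantor × Cantor)} (ho : ∀ k, IsOpen (P k))
    (hd : ∀ k, Dense (P k)) (n ℓ : ℕ) :
    ∃ r : Bool → List Bool, ((r false).length = (r true).length ∧ 1 ≤ (r false).length ∧
      r false ≠ r true) ∧ ∀ k ≤ n, ∀ v v' : List Bool, v.length = ℓ → v'.length = ℓ →
        ∀ i c c', (app (v ++ r i) c, app (v' ++ r (!i)) c') ∈ P k := by
  let ι := Fin (n + 1) × List.Vector Bool ℓ × List.Vector Bool ℓ × Bool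
  let f : ι → Cantor × Cantor → Cantor × Cantor := fun j z =>
    bif j.2.2.2 then (app j.2.1.1 z.2, app j.2.2.1.1 z.1) else (app j.2.1.1 z.1, app j.2.2.1.1 z.2)
  have hf : ∀ j, Continuous (f j) ∧ IsOpenMap (f j) := by
    rintro ⟨k, v, v', i⟩
    have h₁ := (continuous_app v.1).prodMap (continuous_app v'.1)
    have h₂ := (isOpenMap_app v.1).prodMap (isOpenMap_app v'.1)
    cases i
    · exact ⟨h₁, h₂⟩
    · exact ⟨h₁.comp continuous_swap, h₂.comp (Homeomorph.prodComm _ _).isOpenMap⟩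
  let Q : Set (Cantor × Cantor) := (⋂ j : ι, f j ⁻¹' P j.1) ∩ {z | z.1 ≠ z.2}
  have hne : IsOpen {z : Cantor × Cantor | z.1 ≠ z.2} :=
    (isClosed_eq continuous_fst continuous_snd).isOpen_compl
  have hQo : IsOpen Q := (isOpen_iInter_of_finite fun j => (ho _).preimage (hf j).1).inter hne
  have hQd : Dense Q := (dense_iInter_of_isOpen (fun j => (ho _).preimage (hf j).1)
    fun j => (hd _).preimage (hf j).2).inter_of_isOpen_right dense_setOf_ne hne
  obtain ⟨z, hz⟩ := hQd.nonempty
  obtain ⟨m, hm⟩ : ∃ m, ∀ c c', (app (List.ofFn fun i : Fin m => z.1 i) c,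
      app (List.ofFn fun i : Fin m => z.2 i) c') ∈ Q := by
    by_contra! h
    choose c c' h using h
    have ht : Tendsto (fun m => (app (List.ofFn fun i : Fin m => z.1 i) (c m),
        app (List.ofFn fun i : Fin m => z.2 i) (c' m))) atTop (𝓝 z) :=
      (tendsto_of_agree fun n i hi => by simp [app, hi]).prodMk_nhds
        (tendsto_of_agree fun n i hi => by simp [app, hi])
    obtain ⟨k, hk⟩ := (ht.eventually (hQo.mem_nhds hz)).exists
    exact h k hk
  let r : Bool → List Bool := fun i => List.ofFn fun j : Fin m => (bif i then z.2 else z.1) j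
  have hr : r false ≠ r true := fun h => (hm z.1 z.1).2 (congrArg (fun w => app w z.1) h)
  refine ⟨r, ⟨by simp [r], ?_, hr⟩, fun k hk v v' hv hv' i c c' => ?_⟩
  · rcases Nat.eq_zero_or_pos m with rfl | h
    · exact absurd rfl hr
    · exact (List.length_ofFn ..).symm ▸ h
  · rw [app_append, app_append]
    cases i
    · exact Set.mem_iInter.1 (hm c c').1
        ((⟨k, Nat.lt_succ_of_le hk⟩, ⟨v, hv⟩, ⟨v', hv'⟩, false) : ι)
    · exact Set.mem_iInter.1 (hm c' c).1
        ((⟨k, Nat.lt_succ_of_le hk⟩, ⟨v, hv⟩, ⟨v', hv'⟩, true) : ι)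

theorem IsMeagre.exists_array {R : Set (Cantor × Cantor)} (hR : IsMeagre R) :
    ∃ w, ∀ a b, ¬ eZero a b → (xua w a, xua w b) ∉ R := by
  obtain ⟨t, htR, htG, htd⟩ := mem_residual.1 hR
  obtain ⟨P, hP, rfl⟩ := htG.eq_iInter_nat
  choose r hr hrP using exists_generic_block hP fun k => htd.mono (Set.iInter_subset _ k)
  let ℓ : ℕ → ℕ := fun n => Nat.rec 0 (fun n l => l + (r n l false).length) n
  let w : E0Array := ⟨fun n => r n (ℓ n), fun n => (hr n (ℓ n)).1, fun n => (hr n (ℓ n)).2.1,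
    fun n => (hr n (ℓ n)).2.2⟩
  have hlen : ∀ n a, (pre w n a).length = ℓ n := by
    intro n a
    induction n with
    | zero => rfl
    | succ n ih =>
      rw [pre_succ, List.length_append, ih, w.length_u]
  refine ⟨w, fun a b hab hRab => htR (Set.mem_iInter.2 fun k => ?_) hRab⟩
  obtain ⟨n, hkn, hn⟩ : ∃ n ≥ k, a n ≠ b n := by
    by_contra! h
    exact hab (eZero_iff.2 ⟨k, h⟩)
  obtain ⟨c, hc⟩ := xua_eq_app w (n + 1) a
  obtain ⟨c', hc'⟩ := xua_eq_app w (n + 1) b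
  rw [hc, hc', pre_succ, pre_succ]
  have h := hrP n (ℓ n) k hkn (pre w n a) (pre w n b) (hlen n a) (hlen n b) (a n) c c'
  rwa [show (!a n) = b n by cases h : a n <;> cases h' : b n <;> simp_all] at h

theorem exists_array_full_or_trivial {H : Cantor → Cantor → Prop}
    (hH : MeasurableSet {p : Cantor × Cantor | H p.1 p.2}) (he : Equivalence H)
    (hH₀ : ∀ x y, H x y → eZero x y) :
    ∃ w, (∀ a b, eZero a b → H (xua w a) (xua w b)) ∨
      ∀ a b, H (xua w a) (xua w b) → a = b := by
  rcases transversallySmall_or_exists_canonical hH he hH₀ MeasurableSet.univ with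
    ⟨B, hm, ht, hc⟩ | ⟨U, -, hU⟩
  · obtain ⟨n, hn⟩ : ∃ n, ¬ TransversallySmall eZero (B n) := by
      by_contra! h
      exact not_transversallySmall_univ ((TransversallySmall.iUnion h).mono hc)
    obtain ⟨U, hU, -⟩ := (transversallySmall_or_exists_canonical measurableSet_eZero
      eZero_equivalence (fun _ _ => id) (hm n)).resolve_left hn
    exact ⟨U, Or.inr fun a b hab => xua_injective U
      (ht n _ (hU ⟨a, rfl⟩) _ (hU ⟨b, rfl⟩) hab)⟩
  · exact ⟨U, Or.inl hU⟩

/-! ### Groups of Borel automorphisms of the double cover -/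

/-- A countable group of Borel automorphisms of `Cantor × Bool` commuting with the sheet
exchange and identifying no point with its exchange. -/
structure IsSheetGroup (Γ : Subgroup (Equiv.Perm (Cantor × Bool))) : Prop where
  countable : (Γ : Set (Equiv.Perm (Cantor × Bool))).Countable
  measurable : ∀ γ ∈ Γ, Measurable γ
  exchange : ∀ γ ∈ Γ, ∀ x b, γ (x, !b) = ((γ (x, b)).1, !(γ (x, b)).2)
  free : ∀ γ ∈ Γ, ∀ x b, γ (x, b) ≠ (x, !b)

/-- `x` and `y` are joined by `Γ` with sheet shift `ε`. -/
def SheetJoined (Γ : Subgroup (Equiv.Perm (Cantor × Bool))) (ε : Bool) (x y : Cantor) : Prop :=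
  ∃ γ ∈ Γ, γ (x, false) = (y, ε)

theorem SheetJoined.mono {Γ Γ' : Subgroup (Equiv.Perm (Cantor × Bool))} (h : Γ ≤ Γ') {ε : Bool}
    {x y : Cantor} (hxy : SheetJoined Γ ε x y) : SheetJoined Γ' ε x y := by
  obtain ⟨γ, hγ, h'⟩ := hxy
  exact ⟨γ, h hγ, h'⟩

theorem sheetJoined_refl (Γ : Subgroup (Equiv.Perm (Cantor × Bool))) (x : Cantor) :
    SheetJoined Γ false x x :=
  ⟨1, Γ.one_mem, rfl⟩

namespace IsSheetGroup

variable {Γ Γ' : Subgroup (Equiv.Perm (Cantor × Bool))} {ε δ : Bool} {x y z : Cantor}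

theorem apply_eq (hΓ : IsSheetGroup Γ) {γ : Equiv.Perm (Cantor × Bool)} (hγ : γ ∈ Γ)
    (h : γ (x, false) = (y, ε)) (b : Bool) : γ (x, b) = (y, xor b ε) := by
  cases b
  · simpa using h
  · simpa [h] using hΓ.exchange γ hγ x false

theorem trans (hΓ : IsSheetGroup Γ) (h : SheetJoined Γ ε x y) (h' : SheetJoined Γ δ y z) :
    SheetJoined Γ (xor ε δ) x z := by
  obtain ⟨γ, hγ, h⟩ := h
  obtain ⟨γ', hγ', h'⟩ := h'
  exact ⟨γ' * γ, Γ.mul_mem hγ' hγ, by rw [Equiv.Perm.mul_apply, h, hΓ.apply_eq hγ' h']⟩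

theorem symm (hΓ : IsSheetGroup Γ) (h : SheetJoined Γ ε x y) : SheetJoined Γ ε y x := by
  obtain ⟨γ, hγ, h⟩ := h
  refine ⟨γ⁻¹, Γ.inv_mem hγ, ?_⟩
  rw [Equiv.Perm.inv_eq_iff_eq, hΓ.apply_eq hγ h, Bool.xor_self]

theorem unique (hΓ : IsSheetGroup Γ) (h : SheetJoined Γ ε x y) (h' : SheetJoined Γ δ x y) : ε = δ := by
  obtain ⟨γ, hγ, h⟩ := hΓ.trans h (hΓ.symm h')
  have := hΓ.free γ hγ x false
  rw [h] at this
  revert this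
  cases ε <;> cases δ <;> simp

theorem measurableSet_joined (hΓ : IsSheetGroup Γ) (ε : Bool) :
    MeasurableSet {p : Cantor × Cantor | SheetJoined Γ ε p.1 p.2} := by
  have : {p : Cantor × Cantor | SheetJoined Γ ε p.1 p.2} =
      ⋃ γ ∈ Γ, {p | γ (p.1, false) = (p.2, ε)} := by
    ext p
    simp [SheetJoined]
  rw [this]
  exact MeasurableSet.biUnion hΓ.countable fun γ hγ => measurableSet_eq_fun
    ((hΓ.measurable γ hγ).comp (measurable_fst.prodMk measurable_const))
    (measurable_snd.prodMk measurable_const)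

theorem countable_joined (hΓ : IsSheetGroup Γ) (ε : Bool) (x : Cantor) :
    {y | SheetJoined Γ ε x y}.Countable := by
  refine (hΓ.countable.image fun γ => (γ (x, false)).1).mono ?_
  rintro _ ⟨γ, hγ, h⟩
  exact ⟨γ, hγ, congrArg Prod.fst h⟩

theorem equivalence_false (hΓ : IsSheetGroup Γ) : Equivalence (SheetJoined Γ false) :=
  ⟨sheetJoined_refl Γ, hΓ.symm, hΓ.trans⟩

theorem equivalence_exists (hΓ : IsSheetGroup Γ) : Equivalence fun x y => ∃ ε, SheetJoined Γ ε x y :=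
  ⟨fun x => ⟨_, sheetJoined_refl Γ x⟩, fun ⟨_, h⟩ => ⟨_, hΓ.symm h⟩,
    fun ⟨_, h⟩ ⟨_, h'⟩ => ⟨_, hΓ.trans h h'⟩⟩

theorem measurableSet_exists_joined (hΓ : IsSheetGroup Γ) :
    MeasurableSet {p : Cantor × Cantor | ∃ ε, SheetJoined Γ ε p.1 p.2} := by
  rw [Set.ofPred_exists]
  exact MeasurableSet.iUnion hΓ.measurableSet_joined

theorem not_joined_false (hΓ : IsSheetGroup Γ) (h : SheetJoined Γ true x y) :
    ¬ SheetJoined Γ false x y :=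
  fun h' => Bool.noConfusion (hΓ.unique h h')

theorem dbs (hΓ : IsSheetGroup Γ) (h : ∀ x, ∃ y, SheetJoined Γ true x y) :
    DBS (SheetJoined Γ false) (fun x y => ∃ ε, SheetJoined Γ ε x y) where
  equivD := hΓ.equivalence_false
  equivE := hΓ.equivalence_exists
  borelD := hΓ.measurableSet_joined false
  borelE := hΓ.measurableSet_exists_joined
  countableD := hΓ.countable_joined false
  countableE x := by
    rw [Set.ofPred_exists]
    exact Set.countable_iUnion fun ε => hΓ.countable_joined ε x
  sub _ _ h := ⟨_, h⟩
  double x := by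
    obtain ⟨y, hy⟩ := h x
    refine ⟨y, ⟨_, hy⟩, hΓ.not_joined_false hy, ?_⟩
    rintro z ⟨_ | _, hz⟩
    · exact Or.inl hz
    · exact Or.inr (hΓ.trans (hΓ.symm hy) hz)

theorem dbsle (hΓ' : IsSheetGroup Γ') (h : Γ ≤ Γ') :
    DBSle (SheetJoined Γ false) (fun x y => ∃ ε, SheetJoined Γ ε x y)
      (SheetJoined Γ' false) (fun x y => ∃ ε, SheetJoined Γ' ε x y) := by
  refine ⟨fun _ _ => .mono h, fun _ _ ⟨ε, hε⟩ => ⟨ε, hε.mono h⟩, ?_⟩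
  rintro x y ⟨_ | _, hxy⟩ hxy'
  · exact absurd hxy hxy'
  · exact hΓ'.not_joined_false (hxy.mono h)

end IsSheetGroup

/-! ### The initial group -/

theorem flipAt_comp (F G : Finset ℕ) (x : Cantor) :
    flipAt F (flipAt G x) = flipAt (symmDiff F G) x := by
  funext n
  by_cases hF : n ∈ F <;> by_cases hG : n ∈ G <;>
    simp [flipAt, Finset.mem_symmDiff, hF, hG]

theorem odd_card_symmDiff (F G : Finset ℕ) :
    decide (Odd (symmDiff F G).card) = xor (decide (Odd F.card)) (decide (Odd G.card)) := by
  have h₁ : (symmDiff F G).card = (F \ G).card + (G \ F).card :=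
    Finset.card_union_of_disjoint disjoint_sdiff_sdiff
  have h₂ := Finset.card_sdiff_add_card_inter F G
  have h₃ := Finset.card_sdiff_add_card_inter G F
  rw [Finset.inter_comm] at h₃
  by_cases hF : Odd F.card <;> by_cases hG : Odd G.card <;> simp only [hF, hG] <;>
    simp only [Nat.odd_iff] at hF hG ⊢ <;> simp <;> omega

/-- Finite modifications, changing the sheet according to the parity of the modification. -/
def paritySheetGroup : Subgroup (Equiv.Perm (Cantor × Bool)) where
  carrier := {γ | ∃ F : Finset ℕ, ∀ x b, γ (x, b) = (flipAt F x, xor b (decide (Odd F.card)))}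
  mul_mem' := by
    rintro γ γ' ⟨F, hF⟩ ⟨G, hG⟩
    refine ⟨symmDiff F G, fun x b => ?_⟩
    rw [Equiv.Perm.mul_apply, hG, hF, flipAt_comp, odd_card_symmDiff, Bool.xor_assoc,
      Bool.xor_comm (decide (Odd F.card))]
  one_mem' := ⟨∅, fun x b => by simp [flipAt_eq_self_iff.2]⟩
  inv_mem' := by
    rintro γ ⟨F, hF⟩
    refine ⟨F, fun x b => ?_⟩
    rw [Equiv.Perm.inv_eq_iff_eq, hF, flipAt_flipAt_self]
    simp

theorem sheetJoined_paritySheetGroup {ε : Bool} {x y : Cantor} :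
    SheetJoined paritySheetGroup ε x y ↔
      ∃ F : Finset ℕ, y = flipAt F x ∧ ε = decide (Odd F.card) := by
  constructor
  · rintro ⟨γ, ⟨F, hF⟩, h⟩
    rw [hF, Prod.mk.injEq] at h
    exact ⟨F, h.1.symm, by simp [← h.2]⟩
  · rintro ⟨F, rfl, rfl⟩
    refine ⟨Function.Involutive.toPerm
      (fun p => (flipAt F p.1, xor p.2 (decide (Odd F.card)))) fun p => ?_, ⟨F, fun x b => rfl⟩, ?_⟩
    · simp [flipAt_flipAt_self]
    · exact Prod.ext rfl (Bool.false_xor _)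

theorem isSheetGroup_paritySheetGroup : IsSheetGroup paritySheetGroup where
  countable := by
    choose f hf using fun γ : paritySheetGroup => γ.2
    refine Function.Injective.countable (f := f) fun γ γ' h => Subtype.ext (Equiv.ext fun p => ?_)
    rw [← Prod.mk.eta (p := p), hf, hf, h]
  measurable := by
    rintro γ ⟨F, hF⟩
    have : (γ : Cantor × Bool → Cantor × Bool) =
        Prod.map (flipAt F) fun b => xor b (decide (Odd F.card)) := funext fun p => hF p.1 p.2
    rw [this]
    exact (continuous_flipAt F).measurable.prodMap (measurable_of_countable _)
  exchange := by
    rintro γ ⟨F, hF⟩ x b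
    simp [hF]
  free := by
    rintro γ ⟨F, hF⟩ x b h
    rw [hF, Prod.mk.injEq, flipAt_eq_self_iff] at h
    obtain ⟨rfl, h⟩ := h
    simp at h

theorem ncard_ne_flipAt (F : Finset ℕ) (x : Cantor) :
    {k | x k ≠ flipAt F x k}.ncard = F.card := by
  rw [← Set.ncard_coe_finset]
  congr 1
  ext k
  exact ne_flipAt_iff F x k

theorem sheetJoined_paritySheetGroup_false : SheetJoined paritySheetGroup false = eEven := by
  funext x y
  refine propext (sheetJoined_paritySheetGroup.trans ⟨?_, fun h => ?_⟩)
  · rintro ⟨F, rfl, h⟩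
    refine ⟨eZero_flipAt F x, ?_⟩
    rw [ncard_ne_flipAt]
    simpa using h
  · obtain ⟨F, rfl⟩ := exists_flipAt_of_eZero h.1
    refine ⟨F, rfl, ?_⟩
    have := h.2
    rw [ncard_ne_flipAt] at this
    simpa using this

theorem exists_joined_paritySheetGroup :
    (fun x y => ∃ ε, SheetJoined paritySheetGroup ε x y) = eZero := by
  funext x y
  refine propext ⟨?_, fun h => ?_⟩
  · rintro ⟨ε, h⟩
    obtain ⟨F, rfl, -⟩ := sheetJoined_paritySheetGroup.1 h
    exact eZero_flipAt F x
  · obtain ⟨F, rfl⟩ := exists_flipAt_of_eZero h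
    exact ⟨_, sheetJoined_paritySheetGroup.2 ⟨F, rfl, rfl⟩⟩

theorem sheetJoined_paritySheetGroup_true (x : Cantor) :
    SheetJoined paritySheetGroup true x (flipAt {0} x) :=
  sheetJoined_paritySheetGroup.2 ⟨{0}, rfl, by simp⟩

/-! ### Extending a group by an involution -/

theorem exists_measurable_swap {x F : Cantor → Cantor} (hx : Measurable x)
    (hxi : Function.Injective x) (hF : Measurable F) (hFi : Function.Injective F)
    (hd : ∀ a b, F a ≠ x b) (δ : Bool) :
    ∃ T : Cantor → Cantor, ∃ s : Cantor → Bool, Measurable T ∧ Measurable s ∧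
      (∀ a, T (x a) = F a ∧ s (x a) = δ ∧ T (F a) = x a ∧ s (F a) = δ) ∧
      ∀ y, (∀ a, y ≠ x a) → (∀ a, y ≠ F a) → T y = y ∧ s y = false := by
  classical
  have hx' := hx.measurableEmbedding hxi
  have hF' := hF.measurableEmbedding hFi
  obtain ⟨g, hg, hgx⟩ := hx'.exists_measurable_extend hF fun _ => inferInstance
  obtain ⟨h, hh, hhF⟩ := hF'.exists_measurable_extend hx fun _ => inferInstance
  refine ⟨fun y => if y ∈ Set.range x then g y else if y ∈ Set.range F then h y else y,
    fun y => if y ∈ Set.range x ∪ Set.range F then δ else false,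
    hg.ite hx'.measurableSet_range (hh.ite hF'.measurableSet_range measurable_id),
    measurable_const.ite (hx'.measurableSet_range.union hF'.measurableSet_range) measurable_const,
    fun a => ?_, fun y hy hy' => ?_⟩
  · have hFa : F a ∉ Set.range x := fun ⟨b, hb⟩ => hd a b hb.symm
    simp only [Set.mem_range_self, Set.mem_union, hFa, if_true, if_false, or_true, true_or,
      true_and, and_true]
    exact ⟨congrFun hgx a, congrFun hhF a⟩
  · have h₁ : y ∉ Set.range x := fun ⟨a, ha⟩ => hy a ha.symm
    have h₂ : y ∉ Set.range F := fun ⟨a, ha⟩ => hy' a ha.symm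
    simp [h₁, h₂]

namespace IsSheetGroup

variable {Γ : Subgroup (Equiv.Perm (Cantor × Bool))}

/-- A choice of sheets compatible with `Γ` and with prescribed compatible shifts. -/
theorem exists_potential (hΓ : IsSheetGroup Γ) {x F : Cantor → Cantor} (δ : Bool)
    (h₁ : ∀ a b ε, ¬ SheetJoined Γ ε (F a) (x b))
    (h₂ : ∀ a b ε, SheetJoined Γ ε (F a) (F b) → SheetJoined Γ ε (x a) (x b)) :
    ∃ d : Cantor → Bool, (∀ ε y z, SheetJoined Γ ε y z → d y = xor ε (d z)) ∧
      ∀ a, d (x a) = xor δ (d (F a)) := by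
  classical
  let S : Setoid Cantor := ⟨_, hΓ.equivalence_exists⟩
  let rep : Cantor → Cantor := fun y => (Quotient.mk S y).out
  have hrep : ∀ y, ∃ ε, SheetJoined Γ ε y (rep y) := fun y => S.symm (Quotient.mk_out y)
  choose d₀ hd₀ using hrep
  have hd₀' : ∀ ε y z, SheetJoined Γ ε y z → d₀ y = xor ε (d₀ z) := by
    intro ε y z h
    have hyz : rep y = rep z := congrArg Quotient.out (Quotient.sound (s := S) ⟨ε, h⟩)
    exact hΓ.unique (hd₀ y) (hyz ▸ hΓ.trans h (hd₀ z))
  have key : ∀ a b ε, SheetJoined Γ ε (F a) (F b) →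
      xor (d₀ (F a)) (d₀ (x a)) = xor (d₀ (F b)) (d₀ (x b)) := by
    intro a b ε h
    rw [hd₀' _ _ _ h, hd₀' _ _ _ (h₂ a b ε h)]
    cases ε <;> cases d₀ (F b) <;> cases d₀ (x b) <;> rfl
  let k : Cantor → Bool := fun y =>
    if h : ∃ a ε, SheetJoined Γ ε (F a) y then
      xor δ (xor (d₀ (F h.choose)) (d₀ (x h.choose))) else false
  have hk : ∀ a ε y, SheetJoined Γ ε (F a) y → k y = xor δ (xor (d₀ (F a)) (d₀ (x a))) := by
    intro a ε y h
    have h' : ∃ a ε, SheetJoined Γ ε (F a) y := ⟨a, ε, h⟩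
    obtain ⟨ε', hε'⟩ := h'.choose_spec
    simp only [k, dif_pos h']
    rw [key _ _ _ (hΓ.trans hε' (hΓ.symm h))]
  have hk' : ∀ y, (¬ ∃ a ε, SheetJoined Γ ε (F a) y) → k y = false := fun y h => dif_neg h
  refine ⟨fun y => xor (d₀ y) (k y), fun ε y z h => ?_, fun a => ?_⟩
  · have hkyz : k y = k z := by
      by_cases hy : ∃ a ε, SheetJoined Γ ε (F a) y
      · obtain ⟨a, ε', ha⟩ := hy
        rw [hk a _ _ ha, hk a _ _ (hΓ.trans ha h)]
      · rw [hk' y hy, hk' z]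
        rintro ⟨a, ε', ha⟩
        exact hy ⟨a, _, hΓ.trans ha (hΓ.symm h)⟩
    simp only [hkyz, hd₀' _ _ _ h, Bool.xor_assoc]
  · simp only [hk a _ _ (sheetJoined_refl Γ (F a)), hk' (x a) fun ⟨b, ε, h⟩ => h₁ _ _ _ h]
    cases δ <;> cases d₀ (F a) <;> cases d₀ (x a) <;> rfl

theorem exists_extension (hΓ : IsSheetGroup Γ) {x F : Cantor → Cantor} (hx : Measurable x)
    (hxi : Function.Injective x) (hF : Measurable F) (hFi : Function.Injective F) (δ : Bool)
    (h₁ : ∀ a b ε, ¬ SheetJoined Γ ε (F a) (x b))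
    (h₂ : ∀ a b ε, SheetJoined Γ ε (F a) (F b) → SheetJoined Γ ε (x a) (x b)) :
    ∃ Γ', Γ ≤ Γ' ∧ IsSheetGroup Γ' ∧ ∀ a, SheetJoined Γ' δ (F a) (x a) := by
  obtain ⟨d, hd, hdx⟩ := hΓ.exists_potential δ h₁ h₂
  obtain ⟨T, s, hT, hs, hTs, hTs'⟩ := exists_measurable_swap hx hxi hF hFi
    (fun a b h => h₁ a b false (h ▸ sheetJoined_refl Γ _)) δ
  have hcases : ∀ y, (∃ a, y = x a) ∨ (∃ a, y = F a) ∨ (T y = y ∧ s y = false) := by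
    intro y
    by_cases hy : ∃ a, y = x a
    · exact Or.inl hy
    by_cases hy' : ∃ a, y = F a
    · exact Or.inr (Or.inl hy')
    exact Or.inr (Or.inr (hTs' y (not_exists.1 hy) (not_exists.1 hy')))
  have hinv : Function.Involutive fun p : Cantor × Bool => (T p.1, xor p.2 (s p.1)) := by
    rintro ⟨y, b⟩
    obtain ⟨a, rfl⟩ | ⟨a, rfl⟩ | ⟨h, h'⟩ := hcases y
    · simp [hTs]
    · simp [hTs]
    · simp [h, h']
  let θ : Equiv.Perm (Cantor × Bool) := hinv.toPerm
  have hθ : ∀ y b, θ (y, b) = (T y, xor b (s y)) := fun y b => rfl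
  let c : Cantor × Bool → Bool := fun p => xor p.2 (d p.1)
  let gen : Set (Equiv.Perm (Cantor × Bool)) := Γ ∪ {θ}
  have hgen : gen.Countable := hΓ.countable.union (Set.countable_singleton θ)
  have key : ∀ γ ∈ Subgroup.closure gen, (Measurable γ ∧ Measurable (γ⁻¹ : Equiv.Perm _)) ∧
      (∀ x b, γ (x, !b) = ((γ (x, b)).1, !(γ (x, b)).2)) ∧ ∀ p, c (γ p) = c p := by
    intro γ hγ
    induction hγ using Subgroup.closure_induction with
    | mem γ h =>
      rcases h with h | rfl
      · refine ⟨⟨hΓ.measurable γ h, hΓ.measurable _ (Γ.inv_mem h)⟩, hΓ.exchange γ h, ?_⟩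
        rintro ⟨y, b⟩
        have := hΓ.apply_eq h (Prod.mk.eta (p := γ (y, false))).symm b
        rw [this]
        simp only [c, hd _ _ _ ⟨γ, h, (Prod.mk.eta (p := γ (y, false))).symm⟩, Bool.xor_assoc]
      · have hm : Measurable θ := (hT.comp measurable_fst).prodMk
          ((measurable_of_countable fun p : Bool × Bool => xor p.1 p.2).comp
            (measurable_snd.prodMk (hs.comp measurable_fst)))
        refine ⟨⟨hm, hm⟩, fun x b => by simp [hθ], ?_⟩
        rintro ⟨y, b⟩
        rw [hθ]
        obtain ⟨a, rfl⟩ | ⟨a, rfl⟩ | ⟨h, h'⟩ := hcases y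
        · simp only [c, hTs, hdx, Bool.xor_assoc]
        · simp only [c, hTs, hdx, Bool.xor_assoc]
          cases δ <;> simp
        · simp [c, h, h']
    | one => exact ⟨⟨measurable_id, measurable_id⟩, fun _ _ => rfl, fun _ => rfl⟩
    | mul γ γ' _ _ h h' =>
      refine ⟨⟨h.1.1.comp h'.1.1, ?_⟩, fun x b => ?_, fun p => (h.2.2 _).trans (h'.2.2 p)⟩
      · rw [mul_inv_rev]
        exact h'.1.2.comp h.1.2
      · rw [Equiv.Perm.mul_apply, h'.2.1, h.2.1]
        rfl
    | inv γ _ h =>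
      refine ⟨⟨h.1.2, by simpa using h.1.1⟩, fun x b => ?_, fun p => ?_⟩
      · have hx : γ (γ⁻¹ (x, b)) = (x, b) := γ.apply_symm_apply (x, b)
        rw [Equiv.Perm.inv_eq_iff_eq, h.2.1, Prod.mk.eta, hx]
      · rw [← h.2.2]
        exact congrArg c (γ.apply_symm_apply p)
  refine ⟨Subgroup.closure gen, fun γ hγ => Subgroup.subset_closure (Or.inl hγ),
    ⟨?_, fun γ hγ => (key γ hγ).1.1, fun γ hγ => (key γ hγ).2.1, fun γ hγ x b h => ?_⟩,
    fun a => ⟨θ, Subgroup.subset_closure (Or.inr rfl), ?_⟩⟩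
  · have := hgen.to_subtype
    rw [FreeGroup.closure_eq_range, MonoidHom.coe_range]
    have : Countable (FreeGroup gen) := Quot.mk_surjective.countable
    exact Set.countable_range _
  · have := (key γ hγ).2.2 (x, b)
    rw [h] at this
    simp [c] at this
  · simp [hθ, hTs]

theorem isMeagre_setOf_joined (hΓ : IsSheetGroup Γ) {f g : Cantor → Cantor} (hf : Measurable f)
    (hg : Measurable g) (hgi : Function.Injective g) :
    IsMeagre {p : Cantor × Cantor | ∃ ε, SheetJoined Γ ε (f p.1) (g p.2)} := by
  have : {p : Cantor × Cantor | ∃ ε, SheetJoined Γ ε (f p.1) (g p.2)} =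
      ⋃ i : Bool × Γ, {p | i.2.1 (f p.1, false) = (g p.2, i.1)} := by
    ext p
    simp [SheetJoined]
  have hc : Countable Γ := hΓ.countable.to_subtype
  rw [this]
  refine isMeagre_iUnion fun i => isMeagre_of_forall_eq (measurableSet_eq_fun
    ((hΓ.measurable _ i.2.2).comp ((hf.comp measurable_fst).prodMk measurable_const))
    ((hg.comp measurable_snd).prodMk measurable_const)) fun a b c hb hc => hgi ?_
  exact congrArg Prod.fst ((Eq.symm hb).trans hc)

theorem joined_of_eZero (h₀ : paritySheetGroup ≤ Γ) {x y : Cantor} (h : eZero x y) :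
    ∃ ε, SheetJoined Γ ε x y := by
  rw [← exists_joined_paritySheetGroup] at h
  exact h.imp fun _ h => h.mono h₀

theorem measurableSet_setOf_joined (hΓ : IsSheetGroup Γ) {F : Cantor → Cantor}
    (hF : Measurable F) (ε : Bool) :
    MeasurableSet {p : Cantor × Cantor | SheetJoined Γ ε (F p.1) (F p.2)} :=
  (hΓ.measurableSet_joined ε).preimage (hF.prodMap hF)

theorem exists_array_joined_imp (hΓ : IsSheetGroup Γ) (h₀ : paritySheetGroup ≤ Γ) (U : E0Array)
    {F : Cantor → Cantor} (hF : Measurable F) :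
    ∃ w, ∀ a b ε, eZero a b → SheetJoined Γ ε (F (xua w a)) (F (xua w b)) →
      SheetJoined Γ ε (xua U (xua w a)) (xua U (xua w b)) := by
  have hx : Measurable (xua U) := (continuous_xua U).measurable
  obtain ⟨w, hw | hw⟩ := exists_array_full_or_trivial
    (H := fun a b => eZero a b ∧ ∃ ε, SheetJoined Γ ε (F a) (F b) ∧
      SheetJoined Γ ε (xua U a) (xua U b))
    (by
      rw [Set.ofPred_and, Set.ofPred_exists]
      exact measurableSet_eZero.inter (MeasurableSet.iUnion fun ε =>
        (hΓ.measurableSet_setOf_joined hF ε).inter (hΓ.measurableSet_setOf_joined hx ε)))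
    ⟨fun a => ⟨eZero_equivalence.refl a, _, sheetJoined_refl Γ _, sheetJoined_refl Γ _⟩,
      fun ⟨h, ε, h₁, h₂⟩ => ⟨eZero_equivalence.symm h, ε, hΓ.symm h₁, hΓ.symm h₂⟩,
      fun ⟨h, ε, h₁, h₂⟩ ⟨h', ε', h₁', h₂'⟩ => ⟨eZero_equivalence.trans h h', _,
        hΓ.trans h₁ h₁', hΓ.trans h₂ h₂'⟩⟩ fun _ _ h => h.1
  · refine ⟨w, fun a b ε hab h => ?_⟩
    obtain ⟨-, ε', h₁, h₂⟩ := hw a b hab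
    rwa [hΓ.unique h h₁]
  let G : Cantor → Cantor := fun a => F (xua w a)
  have hG : Measurable G := hF.comp (continuous_xua w).measurable
  obtain ⟨v, hv | hv⟩ := exists_array_full_or_trivial
    (H := fun a b => eZero a b ∧ ∃ ε, SheetJoined Γ ε (G a) (G b))
    (by
      rw [Set.ofPred_and, Set.ofPred_exists]
      exact measurableSet_eZero.inter (MeasurableSet.iUnion (hΓ.measurableSet_setOf_joined hG)))
    ⟨fun a => ⟨eZero_equivalence.refl a, _, sheetJoined_refl Γ _⟩,
      fun ⟨h, ε, h₁⟩ => ⟨eZero_equivalence.symm h, ε, hΓ.symm h₁⟩,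
      fun ⟨h, ε, h₁⟩ ⟨h', ε', h₁'⟩ => ⟨eZero_equivalence.trans h h', _, hΓ.trans h₁ h₁'⟩⟩
    fun _ _ h => h.1
  · exfalso
    have key : ∀ a b, eZero a b → a ≠ b → ∃ ε, SheetJoined Γ ε (G (xua v a)) (G (xua v b)) ∧
        SheetJoined Γ (!ε) (xua U (xua w (xua v a))) (xua U (xua w (xua v b))) := by
      intro a b hab hne
      obtain ⟨-, ε, hε⟩ := hv a b hab
      have hab' := eZero_xua w (eZero_xua v hab)
      obtain ⟨ε', hε'⟩ := joined_of_eZero h₀ (eZero_xua U hab')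
      have hεε' : ε' = !ε := by
        rw [Bool.eq_not_iff]
        rintro rfl
        exact hne (xua_injective v (hw _ _ ⟨hab', _, hε, hε'⟩))
      exact ⟨ε, hε, hεε' ▸ hε'⟩
    let z : Cantor := fun _ => false
    have h₁ : eZero z (flipAt {0} z) := eZero_flipAt _ _
    have h₂ : eZero z (flipAt {1} z) := eZero_flipAt _ _
    obtain ⟨ε₁, h₁₁, h₁₂⟩ := key _ _ h₁ fun h => by
      simpa using flipAt_eq_self_iff.1 h.symm
    obtain ⟨ε₂, h₂₁, h₂₂⟩ := key _ _ h₂ fun h => by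
      simpa using flipAt_eq_self_iff.1 h.symm
    obtain ⟨ε₃, h₃₁, h₃₂⟩ := key _ _
      (eZero_equivalence.trans (eZero_equivalence.symm h₁) h₂) fun h => by
        simpa [flipAt, z] using congrFun h 0
    have e₁ := hΓ.unique (hΓ.trans h₁₁ h₃₁) h₂₁
    have e₂ := hΓ.unique (hΓ.trans h₁₂ h₃₂) h₂₂
    revert e₁ e₂
    cases ε₁ <;> cases ε₂ <;> cases ε₃ <;> simp
  · obtain ⟨V, hV⟩ := exists_xua_comp w v
    refine ⟨V, fun a b ε hab h => ?_⟩
    rw [hV, hV] at h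
    obtain rfl := hv a b ⟨eZero_xua v hab, ε, h⟩
    rw [hΓ.unique h (sheetJoined_refl Γ _)]
    exact sheetJoined_refl Γ _

/-- The basic extension step: accommodate a Borel injection moving points off their classes. -/
theorem exists_array_extension (hΓ : IsSheetGroup Γ) (h₀ : paritySheetGroup ≤ Γ) (U : E0Array)
    {F : Cantor → Cantor} (hF : Measurable F) (hFi : Function.Injective F)
    (hd : ∀ a ε, ¬ SheetJoined Γ ε (F a) (xua U a)) (δ : Bool) :
    ∃ w Γ', Γ ≤ Γ' ∧ IsSheetGroup Γ' ∧
      ∀ a, SheetJoined Γ' δ (F (xua w a)) (xua U (xua w a)) := by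
  obtain ⟨w, hw⟩ := hΓ.exists_array_joined_imp h₀ U hF
  have hwm : Measurable (xua w) := (continuous_xua w).measurable
  have hFw : Measurable fun a => F (xua w a) := hF.comp hwm
  have hFwi : Function.Injective fun a => F (xua w a) := hFi.comp (xua_injective w)
  have hUw : Measurable fun a => xua U (xua w a) := (continuous_xua U).measurable.comp hwm
  have hUwi : Function.Injective fun a => xua U (xua w a) :=
    (xua_injective U).comp (xua_injective w)
  obtain ⟨v, hv⟩ := ((hΓ.isMeagre_setOf_joined hFw hUw hUwi).union
    (hΓ.isMeagre_setOf_joined hFw hFw hFwi)).exists_array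
  obtain ⟨V, hV⟩ := exists_xua_comp w v
  have h₁ : ∀ a b ε, ¬ SheetJoined Γ ε (F (xua V a)) (xua U (xua V b)) := by
    intro a b ε h
    simp only [hV] at h
    by_cases hab : eZero a b
    · obtain ⟨ε', h'⟩ := joined_of_eZero h₀
        (eZero_xua U (eZero_xua w (eZero_xua v (eZero_equivalence.symm hab))))
      exact hd _ _ (hΓ.trans h h')
    · exact hv a b hab (Or.inl ⟨ε, h⟩)
  have h₂ : ∀ a b ε, SheetJoined Γ ε (F (xua V a)) (F (xua V b)) →
      SheetJoined Γ ε (xua U (xua V a)) (xua U (xua V b)) := by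
    intro a b ε h
    simp only [hV] at h ⊢
    by_cases hab : eZero a b
    · exact hw _ _ _ (eZero_xua v hab) h
    · exact absurd (Or.inr ⟨ε, h⟩) (hv a b hab)
  have hVm : Measurable (xua V) := (continuous_xua V).measurable
  exact ⟨V, hΓ.exists_extension ((continuous_xua U).measurable.comp hVm)
    ((xua_injective U).comp (xua_injective V)) (hF.comp hVm) (hFi.comp (xua_injective V)) δ h₁ h₂⟩

/-- Accommodation of an arbitrary Borel injection. -/
theorem exists_accommodation (hΓ : IsSheetGroup Γ) (h₀ : paritySheetGroup ≤ Γ) (U : E0Array)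
    {F : Cantor → Cantor} (hF : Measurable F) (hFi : Function.Injective F) :
    ∃ w Γ', Γ ≤ Γ' ∧ IsSheetGroup Γ' ∧
      ∀ a, ∃ ε, SheetJoined Γ' ε (F (xua w a)) (xua U (xua w a)) := by
  let M : Set Cantor := {a | ∃ ε, SheetJoined Γ ε (F a) (xua U a)}
  have hM : MeasurableSet M :=
    hΓ.measurableSet_exists_joined.preimage (hF.prodMk (continuous_xua U).measurable)
  rcases transversallySmall_or_exists_canonical measurableSet_eZero eZero_equivalence
    (fun _ _ => id) hM with hs | ⟨w, hw, -⟩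
  · rcases transversallySmall_or_exists_canonical measurableSet_eZero eZero_equivalence
      (fun _ _ => id) hM.compl with hs' | ⟨w, hw, -⟩
    · exact absurd ((hs.union hs').mono (Set.union_compl_self M).ge) not_transversallySmall_univ
    obtain ⟨V, hV⟩ := exists_xua_comp U w
    obtain ⟨v, Γ', hΓΓ', hΓ', h⟩ := hΓ.exists_array_extension h₀ V
      (F := fun a => F (xua w a)) (hF.comp (continuous_xua w).measurable)
      (hFi.comp (xua_injective w))
      (fun a ε h => hw ⟨a, rfl⟩ ⟨ε, hV a ▸ h⟩) false
    obtain ⟨W, hW⟩ := exists_xua_comp w v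
    refine ⟨W, Γ', hΓΓ', hΓ', fun a => ⟨false, ?_⟩⟩
    rw [hW, ← hV]
    exact h a
  · exact ⟨w, Γ, le_rfl, hΓ, fun a => hw ⟨a, rfl⟩⟩

/-- Two canonical maps with prescribed sheet shift. -/
theorem exists_canonical_shift (hΓ : IsSheetGroup Γ) (h₀ : paritySheetGroup ≤ Γ)
    (U R : E0Array) (δ : Bool) :
    ∃ w w' Γ', Γ ≤ Γ' ∧ IsSheetGroup Γ' ∧
      ∀ a, SheetJoined Γ' δ (xua R (xua w' a)) (xua U (xua w a)) := by
  obtain ⟨w, hw⟩ := (hΓ.isMeagre_setOf_joined (continuous_xua R).measurable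
    (continuous_xua U).measurable (xua_injective U)).exists_array
  let w' : E0Array := ⟨fun n i => w.u n (!i), fun n => (w.len_eq n).symm,
    fun n => w.len_eq n ▸ w.len_pos n, fun n => (w.ne n).symm⟩
  have hw' : ∀ a, xua w' a = xua w fun n => !a n := fun a => rfl
  obtain ⟨U', hU'⟩ := exists_xua_comp U w
  obtain ⟨R', hR'⟩ := exists_xua_comp R w'
  obtain ⟨v, Γ', hΓΓ', hΓ', h⟩ := hΓ.exists_array_extension h₀ U' (continuous_xua R').measurable
    (xua_injective R') (fun a ε h => by
      rw [hR', hU', hw'] at h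
      refine hw _ _ (fun hf => ?_) ⟨ε, h⟩
      obtain ⟨n, hn⟩ := eZero_iff.1 hf
      simpa using hn n le_rfl) δ
  obtain ⟨V, hV⟩ := exists_xua_comp w v
  obtain ⟨V', hV'⟩ := exists_xua_comp w' v
  refine ⟨V, V', Γ', hΓΓ', hΓ', fun a => ?_⟩
  rw [hV, hV', ← hU', ← hR']
  exact h a

end IsSheetGroup

/-! ### The transfinite tower of groups -/

/-- The tower of groups obtained from the parity group by applying `step β` to stage `β`,
collecting the results at every later stage. -/
noncomputable def tower
    (step : Ordinal → Subgroup (Equiv.Perm (Cantor × Bool)) → Subgroup (Equiv.Perm (Cantor × Bool)))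
    (α : Ordinal) : Subgroup (Equiv.Perm (Cantor × Bool)) :=
  paritySheetGroup ⊔ ⨆ β : Set.Iio α, step β.1 (tower step β.1)
termination_by α
decreasing_by exact β.2

section Tower

variable {step : Ordinal → Subgroup (Equiv.Perm (Cantor × Bool)) →
  Subgroup (Equiv.Perm (Cantor × Bool))}

theorem paritySheetGroup_le_tower (α : Ordinal) : paritySheetGroup ≤ tower step α := by
  rw [tower]
  exact le_sup_left

theorem step_le_tower {α β : Ordinal} (h : β < α) : step β (tower step β) ≤ tower step α := by
  rw [tower.eq_1 step α]
  exact le_sup_of_le_right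
    (le_iSup (fun β : Set.Iio α => step β.1 (tower step β.1)) ⟨β, h⟩)

theorem tower_mono {α β : Ordinal} (h : α ≤ β) : tower step α ≤ tower step β := by
  rw [tower.eq_1 step α]
  exact sup_le (paritySheetGroup_le_tower β)
    (iSup_le fun γ => step_le_tower (lt_of_lt_of_le γ.2 h))

theorem tower_zero : tower step 0 = paritySheetGroup := by
  rw [tower, iSup_of_empty, sup_bot_eq]

theorem tower_eq_iSup (hstep : ∀ α Γ, Γ ≤ step α Γ) {α : Ordinal} (hα : α ≠ 0) :
    tower step α = ⨆ β : Set.Iio α, step β.1 (tower step β.1) := by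
  rw [tower.eq_1 step α, sup_eq_right]
  exact ((paritySheetGroup_le_tower 0).trans (hstep 0 _)).trans
    (le_iSup (fun β : Set.Iio α => step β.1 (tower step β.1)) ⟨0, pos_iff_ne_zero.2 hα⟩)

theorem isSheetGroup_iSup {ι : Type*} [Nonempty ι] [Countable ι]
    {Γ : ι → Subgroup (Equiv.Perm (Cantor × Bool))} (hd : Directed (· ≤ ·) Γ)
    (hΓ : ∀ i, IsSheetGroup (Γ i)) : IsSheetGroup (⨆ i, Γ i) where
  countable := by
    rw [Subgroup.coe_iSup_of_directed hd]
    exact Set.countable_iUnion fun i => (hΓ i).countable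
  measurable γ h := by
    obtain ⟨i, hi⟩ := (Subgroup.mem_iSup_of_directed hd).1 h
    exact (hΓ i).measurable γ hi
  exchange γ h := by
    obtain ⟨i, hi⟩ := (Subgroup.mem_iSup_of_directed hd).1 h
    exact (hΓ i).exchange γ hi
  free γ h := by
    obtain ⟨i, hi⟩ := (Subgroup.mem_iSup_of_directed hd).1 h
    exact (hΓ i).free γ hi

theorem isSheetGroup_tower (hstep : ∀ α Γ, Γ ≤ step α Γ)
    (hs : ∀ α Γ, IsSheetGroup Γ → paritySheetGroup ≤ Γ → IsSheetGroup (step α Γ))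
    {α : Ordinal} (hα : α < (Cardinal.aleph 1).ord) : IsSheetGroup (tower step α) := by
  induction α using WellFoundedLT.induction with
  | _ α ih =>
    rcases eq_or_ne α 0 with rfl | h0
    · rw [tower_zero]
      exact isSheetGroup_paritySheetGroup
    rw [tower_eq_iSup hstep h0]
    have : Nonempty (Set.Iio α) := ⟨⟨0, pos_iff_ne_zero.2 h0⟩⟩
    have : Countable (Set.Iio α) := by
      rw [← Cardinal.mk_le_aleph0_iff, Cardinal.mk_Iio_ordinal, Cardinal.lift_le_aleph0]
      exact Cardinal.lt_aleph_one_iff.1 (Cardinal.lt_ord.1 hα)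
    refine isSheetGroup_iSup (directed_of_isDirected_le fun β γ h => ?_) fun β =>
      hs _ _ (ih β.1 β.2 (lt_trans β.2 hα)) (paritySheetGroup_le_tower _)
    rcases eq_or_lt_of_le h with rfl | h
    · exact le_rfl
    · exact (step_le_tower h).trans (hstep _ _)

end Tower

/-! ### Enumerating the tasks -/

open Cardinal in
theorem exists_ordinal_enumeration {T : Type} [Nonempty T] (hT : #T ≤ aleph 1) :
    ∃ e : Ordinal → T, ∀ t, ∃ α < (aleph 1).ord, e α = t := by
  have h : Nonempty (T ↪ Set.Iio (aleph 1).ord) := by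
    rw [← lift_mk_le', mk_Iio_ordinal, card_ord]
    simpa using hT
  obtain ⟨i⟩ := h
  have hi : Function.Injective fun t => (i t).1 := Subtype.val_injective.comp i.injective
  exact ⟨Function.invFun fun t => (i t).1, fun t =>
    ⟨(i t).1, (i t).2, Function.leftInverse_invFun hi t⟩⟩

open Cardinal in
theorem mk_array_le : #E0Array ≤ continuum := by
  have hi : Function.Injective E0Array.u := by
    rintro ⟨u, _, _, _⟩ ⟨v, _, _, _⟩ rfl
    rfl
  refine (mk_le_of_injective hi).trans ?_
  simp

open Cardinal in
theorem mk_measurable_le : #{F : Cantor → Cantor // Measurable F} ≤ continuum := by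
  have hm : #{s : Set Cantor // MeasurableSet s} ≤ continuum := by
    obtain ⟨b, hb, h⟩ := MeasurableSpace.CountablyGenerated.isCountablyGenerated (α := Cantor)
    rw [h]
    exact MeasurableSpace.cardinal_measurableSet_le_continuum
      ((mk_le_aleph0_iff.2 hb.to_subtype).trans aleph0_le_continuum)
  let φ : {F : Cantor → Cantor // Measurable F} → ℕ → {s : Set Cantor // MeasurableSet s} :=
    fun F n => ⟨{x | F.1 x n = true}, (measurable_pi_apply n).comp F.2 (measurableSet_singleton true)⟩
  have hφ : Function.Injective φ := fun F G h => by
    ext x n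
    have := congrArg (fun s => x ∈ s.1) (congrFun h n)
    exact Bool.eq_iff_iff.2 (iff_of_eq this)
  refine (mk_le_of_injective hφ).trans ?_
  rw [← power_def, mk_nat, ← continuum_power_aleph0]
  exact power_le_power_right hm

/-- The requests served along the tower: accommodating an injection, or finding
canonical maps between two canonical sets. -/
abbrev Request : Type :=
  (E0Array × {F : Cantor → Cantor // Measurable F}) ⊕ (E0Array × E0Array)

/-- A group serves a request. -/
def Serves (Γ : Subgroup (Equiv.Perm (Cantor × Bool))) : Request → Prop
  | .inl (U, F) => Function.Injective F.1 → ∃ w : E0Array, ∀ a, ∃ ε,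
      SheetJoined Γ ε (F.1 (xua w a)) (xua U (xua w a))
  | .inr (X, R) => ∃ U V W : E0Array, Du U ⊆ Du X ∧ Du V ⊆ Du R ∧ Du W ⊆ Du R ∧
      ∀ a, SheetJoined Γ false (xua V a) (xua U a) ∧ SheetJoined Γ true (xua W a) (xua U a)

theorem range_xua_subset {U V w : E0Array} (h : ∀ a, xua V a = xua U (xua w a)) : Du V ⊆ Du U := by
  rintro _ ⟨a, rfl⟩
  exact ⟨_, (h a).symm⟩

theorem IsSheetGroup.exists_serves {Γ : Subgroup (Equiv.Perm (Cantor × Bool))}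
    (hΓ : IsSheetGroup Γ) (h₀ : paritySheetGroup ≤ Γ) (t : Request) :
    ∃ Γ', Γ ≤ Γ' ∧ IsSheetGroup Γ' ∧ Serves Γ' t := by
  rcases t with ⟨U, F⟩ | ⟨X, R⟩
  · by_cases hF : Function.Injective F.1
    · obtain ⟨w, Γ', h, h', hw⟩ := hΓ.exists_accommodation h₀ U F.2 hF
      exact ⟨Γ', h, h', fun _ => ⟨w, hw⟩⟩
    · exact ⟨Γ, le_rfl, hΓ, fun h => absurd h hF⟩
  · obtain ⟨w, w', Γ₁, h₁, hΓ₁, hw⟩ := hΓ.exists_canonical_shift h₀ X R false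
    obtain ⟨U₁, hU₁⟩ := exists_xua_comp X w
    obtain ⟨V₁, hV₁⟩ := exists_xua_comp R w'
    obtain ⟨z, z', Γ₂, h₂, hΓ₂, hz⟩ := hΓ₁.exists_canonical_shift (h₀.trans h₁) U₁ R true
    obtain ⟨U, hU⟩ := exists_xua_comp U₁ z
    obtain ⟨V, hV⟩ := exists_xua_comp V₁ z
    obtain ⟨W, hW⟩ := exists_xua_comp R z'
    refine ⟨Γ₂, h₁.trans h₂, hΓ₂, U, V, W, (range_xua_subset hU).trans (range_xua_subset hU₁),
      (range_xua_subset hV).trans (range_xua_subset hV₁), range_xua_subset hW, fun a => ⟨?_, ?_⟩⟩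
    · rw [hU, hV, hU₁, hV₁]
      exact (hw _).mono h₂
    · rw [hU, hW]
      exact hz a

open Cardinal in
theorem mk_request_le : #Request ≤ continuum := by
  rw [mk_sum, mk_prod, mk_prod]
  simp only [lift_id]
  exact add_le_of_le aleph0_le_continuum
    (mul_le_of_le aleph0_le_continuum mk_array_le mk_measurable_le)
    (mul_le_of_le aleph0_le_continuum mk_array_le mk_array_le)

theorem SheetJoined.exists_true {Γ : Subgroup (Equiv.Perm (Cantor × Bool))}
    (h₀ : paritySheetGroup ≤ Γ) (x : Cantor) : ∃ y, SheetJoined Γ true x y :=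
  ⟨_, (sheetJoined_paritySheetGroup_true x).mono h₀⟩

theorem exists_canonical_of_e0Large {X : Set Cantor} (hX : MeasurableSet X) (h : E0Large X) :
    ∃ U, Du U ⊆ X :=
  (transversallySmall_or_exists_canonical measurableSet_eZero eZero_equivalence
    (fun _ _ => id) hX).elim (fun h' => absurd h'.relSmoothOn h) fun ⟨U, hU, _⟩ => ⟨U, hU⟩

theorem exists_serving_sequence (hCH : Cardinal.continuum.{0} = Cardinal.aleph 1) :
    ∃ Γ : Ordinal → Subgroup (Equiv.Perm (Cantor × Bool)),
      Γ 0 = paritySheetGroup ∧ Monotone Γ ∧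
      (∀ α < (Cardinal.aleph 1).ord, IsSheetGroup (Γ α)) ∧
      ∀ t, ∃ α < (Cardinal.aleph 1).ord, ∃ Γ' ≤ Γ α, Serves Γ' t := by
  have key : ∀ (t : Request) (Γ : Subgroup (Equiv.Perm (Cantor × Bool))), ∃ Γ', Γ ≤ Γ' ∧
      (IsSheetGroup Γ → paritySheetGroup ≤ Γ → IsSheetGroup Γ' ∧ Serves Γ' t) := fun t Γ => by
    by_cases h : IsSheetGroup Γ ∧ paritySheetGroup ≤ Γ
    · obtain ⟨Γ', h₁, h₂⟩ := h.1.exists_serves h.2 t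
      exact ⟨Γ', h₁, fun _ _ => h₂⟩
    · exact ⟨Γ, le_rfl, fun h₁ h₂ => absurd ⟨h₁, h₂⟩ h⟩
  choose g hg hg' using key
  let W : E0Array := ⟨fun _ b => [b], fun _ => rfl, fun _ => le_rfl, fun _ => by simp⟩
  have : Nonempty Request := ⟨.inr (W, W)⟩
  obtain ⟨e, he⟩ := exists_ordinal_enumeration (mk_request_le.trans hCH.le)
  have hT : ∀ α < (Cardinal.aleph 1).ord, IsSheetGroup (tower (fun α => g (e α)) α) := fun α hα =>
    isSheetGroup_tower (fun α => hg (e α)) (fun α Γ h h' => (hg' (e α) Γ h h').1) hα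
  refine ⟨tower fun α => g (e α), tower_zero, fun _ _ => tower_mono, hT, fun t => ?_⟩
  obtain ⟨α, hα, rfl⟩ := he t
  exact ⟨Order.succ α,
    (Cardinal.isSuccLimit_ord (Cardinal.aleph0_le_aleph 1)).succ_lt hα, _,
    step_le_tower (Order.lt_succ α), (hg' (e α) _ (hT α hα) (paritySheetGroup_le_tower α)).2⟩

/-- Under CH there is a `⊑`-increasing `ω₁`-sequence of double-bubble systems, starting
with `⟨Eₑ, E₀⟩`, which accommodates Borel injections defined on Borel `E₀`-large sets
(on a canonical `E₀`-large subset), and which, for any pair of canonical `E₀`-large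
sets `X, R`, positively and negatively accommodates suitable canonical maps of a
canonical `E₀`-large subset of `X` into `R`. -/
theorem increasing_dbs_sequence_e0
    (hCH : Cardinal.continuum = Cardinal.aleph 1) :
    ∃ D E : Ordinal → Cantor → Cantor → Prop,
      (∀ α < (Cardinal.aleph 1).ord, DBS (D α) (E α)) ∧
      (∀ α β : Ordinal, α ≤ β → β < (Cardinal.aleph 1).ord →
        DBSle (D α) (E α) (D β) (E β)) ∧
      D 0 = eEven ∧ E 0 = eZero ∧
      (∀ X : Set Cantor, MeasurableSet X → E0Large X →
        ∀ f : X → Cantor, Measurable f → Function.Injective f →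
        ∃ U : E0Array, Du U ⊆ X ∧ ∃ α < (Cardinal.aleph 1).ord,
          ∀ x : X, ↑x ∈ Du U → E α (f x) ↑x) ∧
      (∀ UX UR : E0Array,
        ∃ U V W : E0Array, Du U ⊆ Du UX ∧ Du V ⊆ Du UR ∧ Du W ⊆ Du UR ∧
          ∃ α < (Cardinal.aleph 1).ord,
            (∀ a : Cantor, D α (xua V a) (xua U a)) ∧
            (∀ a : Cantor, E α (xua W a) (xua U a) ∧
              ¬ D α (xua W a) (xua U a))) := by
  have hCH' : Cardinal.continuum.{0} = Cardinal.aleph 1 := by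
    rw [← Cardinal.lift_inj, Cardinal.lift_continuum, Cardinal.lift_aleph, Ordinal.lift_one, hCH]
  obtain ⟨Γ, h0, hm, hΓ, hs⟩ := exists_serving_sequence hCH'
  have hp : ∀ α, paritySheetGroup ≤ Γ α := fun α => h0 ▸ hm zero_le
  refine ⟨fun α => SheetJoined (Γ α) false, fun α x y => ∃ ε, SheetJoined (Γ α) ε x y,
    fun α hα => (hΓ α hα).dbs (SheetJoined.exists_true (hp α)),
    fun α β h hβ => (hΓ β hβ).dbsle (hm h), ?_, ?_, fun X hX hL f hf hfi => ?_, fun X R => ?_⟩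
  · simp only [h0, sheetJoined_paritySheetGroup_false]
  · simp only [h0, exists_joined_paritySheetGroup]
  · obtain ⟨U₀, hU₀⟩ := exists_canonical_of_e0Large hX hL
    have hU₀' : ∀ a, xua U₀ a ∈ X := fun a => hU₀ ⟨a, rfl⟩
    obtain ⟨α, hα, Γ', hle, hw⟩ := hs (.inl (U₀, ⟨fun a => f ⟨xua U₀ a, hU₀' a⟩,
      hf.comp ((continuous_xua U₀).measurable.subtype_mk)⟩))
    obtain ⟨w, hw⟩ := hw fun a b h => xua_injective U₀ (congrArg Subtype.val (hfi h))
    obtain ⟨U, hU⟩ := exists_xua_comp U₀ w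
    refine ⟨U, (range_xua_subset hU).trans hU₀, α, hα, ?_⟩
    rintro ⟨_, hx⟩ ⟨a, rfl⟩
    obtain ⟨ε, hε⟩ := hw a
    refine ⟨ε, ?_⟩
    simp only [hU]
    exact hε.mono hle
  · obtain ⟨α, hα, Γ', hle, U, V, W, hU, hV, hW, h⟩ := hs (.inr (X, R))
    exact ⟨U, V, W, hU, hV, hW, α, hα, fun a => (h a).1.mono hle, fun a =>
      ⟨⟨true, (h a).2.mono hle⟩, (hΓ α hα).not_joined_false ((h a).2.mono hle)⟩⟩
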